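/- arXiv:2110.07005 — 2 statements merged into one kernel-verified Lean document; each statement's English description precedes it below -/
import Mathlib

section
/- Every finite simple outerplanar graph G satisfies χ⃗(G) ≤ 10. -/
open SimpleGraph Finset

/-- An orientation of a simple graph `G`: each edge gets exactly one direction. -/
structure GOrientation {V : Type*} (G : SimpleGraph V) where
  dir : V → V → Bool
  adj_iff : ∀ u v, G.Adj u v ↔ (dir u v = true ∨ dir v u = true)
  not_both : ∀ u v, ¬(dir u v = true ∧ dir v u = true)

def GOrientation.outDeg {V : Type*} [Fintype V] {G : SimpleGraph V}
    (o : GOrientation G) (u : V) : ℕ :=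
  (Finset.univ.filter fun v => o.dir u v = true).card

def GOrientation.inDeg {V : Type*} [Fintype V] {G : SimpleGraph V}
    (o : GOrientation G) (u : V) : ℕ :=
  (Finset.univ.filter fun v => o.dir v u = true).card

/-- A proper orientation: adjacent vertices get distinct outdegrees. -/
def GOrientation.IsProper {V : Type*} [Fintype V] {G : SimpleGraph V}
    (o : GOrientation G) : Prop :=
  ∀ u v, G.Adj u v → o.outDeg u ≠ o.outDeg v

/-- Maximum average degree: sup over nonempty subgraphs of 2|E(H)|/|V(H)|. -/
noncomputable def mad {V : Type*} [Fintype V] (G : SimpleGraph V) : ℝ :=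
  sSup {x : ℝ | ∃ H : G.Subgraph, H.verts.Nonempty ∧
    x = 2 * H.edgeSet.ncard / H.verts.ncard}

/-- `H` is a minor of `G`: disjoint nonempty connected branch sets with edges realized. -/
def HasMinor {V W : Type*} (G : SimpleGraph V) (H : SimpleGraph W) : Prop :=
  ∃ B : W → Set V,
    (∀ w, (B w).Nonempty) ∧
    (∀ w, (G.induce (B w)).Connected) ∧
    (∀ w₁ w₂, w₁ ≠ w₂ → Disjoint (B w₁) (B w₂)) ∧
    (∀ w₁ w₂, H.Adj w₁ w₂ → ∃ u ∈ B w₁, ∃ v ∈ B w₂, G.Adj u v)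

/-- Planarity via Wagner's theorem: no `K₅` and no `K_{3,3}` minor. -/
def IsPlanar {V : Type*} (G : SimpleGraph V) : Prop :=
  ¬ HasMinor G (completeGraph (Fin 5)) ∧
  ¬ HasMinor G (completeBipartiteGraph (Fin 3) (Fin 3))

/-- Outerplanarity: no `K₄` and no `K_{2,3}` minor. -/
def IsOuterplanar {V : Type*} (G : SimpleGraph V) : Prop :=
  ¬ HasMinor G (completeGraph (Fin 4)) ∧
  ¬ HasMinor G (completeBipartiteGraph (Fin 2) (Fin 3))

/-! ### Partial orientations

A state has a set `U` of undecided vertices; edges inside `U` are present in both directions,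
all other edges are oriented. -/
section states
open Classical

noncomputable def oset {V : Type*} [Fintype V] (o : V → V → Prop) (u : V) : Finset V :=
  univ.filter (o u)

theorem mem_oset {V : Type*} [Fintype V] (o : V → V → Prop) (u v : V) :
    v ∈ oset o u ↔ o u v := by simp [oset]

noncomputable def ocnt {V : Type*} [Fintype V] (o : V → V → Prop) (u : V) : ℕ :=
  (oset o u).card

structure PSt {V : Type*} [Fintype V] (G : SimpleGraph V) (D : V → V → Prop) where
  U : Finset V
  o : V → V → Prop
  o_adj : ∀ u v, o u v → G.Adj u v
  adj_o : ∀ u v, G.Adj u v → o u v ∨ o v u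
  both : ∀ u v, o u v → o v u → u ∈ U
  inner : ∀ u v, u ∈ U → v ∈ U → G.Adj u v → o u v
  outD : ∀ u v, u ∈ U → v ∉ U → o u v → D u v
  proper : ∀ u v, u ∉ U → v ∉ U → G.Adj u v →
    ocnt o u ≠ ocnt o v
  bound : ∀ u, u ∉ U → ocnt o u ≤ 10

variable {V : Type*} [Fintype V] {G : SimpleGraph V} {D : V → V → Prop}

noncomputable def PSt.c (S : PSt G D) (u : V) : ℕ := ocnt S.o u

/-- The undecided vertices `v` whose edge to `y` is directed from `v` to `y` by `D`. -/
noncomputable def PSt.din (S : PSt G D) (y : V) : Finset V := S.U.filter (fun v => D v y)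

theorem PSt.c_le (S : PSt G D) (hD1 : ∀ u v, G.Adj u v → D u v ∨ D v u)
    (hD2 : ∀ u, (univ.filter (D u)).card ≤ 2) (y : V) (hy : y ∈ S.U) :
    S.c y ≤ 2 + (S.din y).card := by
  have : oset S.o y ⊆ univ.filter (D y) ∪ S.din y := by
    intro v hv
    simp only [mem_filter, mem_univ, true_and, mem_union, PSt.din, mem_oset] at hv ⊢
    by_cases hvU : v ∈ S.U
    · rcases hD1 y v (S.o_adj _ _ hv) with h | h
      · exact Or.inl h
      · exact Or.inr ⟨hvU, h⟩
    · exact Or.inl (S.outD y v hy hvU hv)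
  have h1 := card_le_card this
  have h2 := card_union_le (univ.filter (D y)) (S.din y)
  have h3 := hD2 y
  unfold PSt.c ocnt
  omega

theorem PSt.decide1 (S : PSt G D) (hD0 : ∀ u v, D u v → G.Adj u v) (y : V) (hy : y ∈ S.U)
    (A : Finset V) (hA : ∀ v ∈ A, v ∈ S.U ∧ D v y) (s : ℕ) (hs : s ≤ 10)
    (hc : S.c y = s + A.card) (hp : ∀ r, r ∉ S.U → G.Adj y r → S.c r ≠ s) :
    ∃ S' : PSt G D, S'.U = S.U.erase y ∧ S'.c y = s ∧ (∀ r, r ∉ S.U → S'.c r = S.c r) ∧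
      (∀ u ∈ S.U, u ≠ y → S'.c u + (if G.Adj u y ∧ u ∉ A then 1 else 0) = S.c u) := by
  let o' : V → V → Prop := fun u v =>
    S.o u v ∧ ¬ (u = y ∧ v ∈ A) ∧ ¬ (v = y ∧ u ∈ S.U ∧ u ∉ A)
  have hyA : y ∉ A := fun h => (hD0 _ _ (hA y h).2).ne rfl
  have hcy : ocnt o' y = s := by
    unfold ocnt
    have h1 : oset o' y = oset S.o y \ A := by
      ext v
      simp only [mem_oset, mem_sdiff, o', true_and]
      constructor
      · rintro ⟨a, b, c⟩; exact ⟨a, fun h => b h⟩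
      · rintro ⟨a, b⟩
        exact ⟨a, fun h => b h, fun h => (S.o_adj _ _ a).ne h.1.symm⟩
    have h2 : A ⊆ oset S.o y := by
      intro v hv
      simp only [mem_oset]
      exact S.inner _ _ hy (hA v hv).1 (hD0 _ _ (hA v hv).2).symm
    rw [h1, card_sdiff_of_subset h2]
    unfold PSt.c ocnt at hc
    omega
  have hcr : ∀ r, r ∉ S.U → ocnt o' r = ocnt S.o r := by
    intro r hr
    unfold ocnt
    congr 1
    ext v
    simp only [mem_oset, o']
    constructor
    · exact fun h => h.1
    · intro h
      exact ⟨h, fun h' => hr (h'.1 ▸ hy), fun h' => hr h'.2.1⟩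
  have hcu : ∀ u ∈ S.U, u ≠ y → ocnt o' u +
      (if G.Adj u y ∧ u ∉ A then 1 else 0) = ocnt S.o u := by
    intro u hu huy
    unfold ocnt
    split_ifs with h
    · have h1 : oset o' u = (oset S.o u).erase y := by
        ext v
        simp only [mem_oset, mem_erase, o']
        constructor
        · rintro ⟨a, b, c⟩; exact ⟨fun e => c ⟨e, hu, h.2⟩, a⟩
        · rintro ⟨a, b⟩
          exact ⟨b, fun e => huy e.1, fun e => a e.1⟩
      rw [h1]
      apply card_erase_add_one
      simp only [mem_oset]
      exact S.inner _ _ hu hy h.1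
    · rw [add_zero]
      congr 1
      ext v
      simp only [mem_oset, o']
      constructor
      · exact fun h => h.1
      · intro h'
        refine ⟨h', fun e => huy e.1, fun e => h ⟨?_, e.2.2⟩⟩
        rw [← e.1]; exact S.o_adj _ _ h'
  refine ⟨⟨S.U.erase y, o', ?_, ?_, ?_, ?_, ?_, ?_, ?_⟩, rfl, hcy, ?_, ?_⟩
  · exact fun u v h => S.o_adj _ _ h.1
  · intro u v h
    by_cases hu : u = y
    · subst hu
      by_cases hv : v ∈ A
      · right
        exact ⟨S.inner _ _ (hA v hv).1 hy h.symm, fun e => h.ne e.1.symm, fun e => e.2.2 hv⟩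
      · by_cases hvU : v ∈ S.U
        · left
          exact ⟨S.inner _ _ hy hvU h, fun e => hv e.2, fun e => h.ne e.1.symm⟩
        · rcases S.adj_o _ _ h with h' | h'
          · left; exact ⟨h', fun e => hv e.2, fun e => h.ne e.1.symm⟩
          · right; exact ⟨h', fun e => h.ne e.1.symm, fun e => hvU e.2.1⟩
    · by_cases hv : v = y
      · subst hv
        by_cases huA : u ∈ A
        · left
          exact ⟨S.inner _ _ (hA u huA).1 hy h, fun e => h.ne e.1, fun e => e.2.2 huA⟩
        · by_cases huU : u ∈ S.U
          · right
            exact ⟨S.inner _ _ hy huU h.symm, fun e => huA e.2, fun e => h.ne e.1⟩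
          · rcases S.adj_o _ _ h with h' | h'
            · left; exact ⟨h', fun e => h.ne e.1, fun e => huU e.2.1⟩
            · right; exact ⟨h', fun e => huA e.2, fun e => h.ne e.1⟩
      · rcases S.adj_o _ _ h with h' | h'
        · left; exact ⟨h', fun e => hu e.1, fun e => hv e.1⟩
        · right; exact ⟨h', fun e => hv e.1, fun e => hu e.1⟩
  · intro u v h1 h2
    have hu := S.both _ _ h1.1 h2.1
    have hv := S.both _ _ h2.1 h1.1
    rw [mem_erase]
    refine ⟨?_, hu⟩
    rintro rfl
    by_cases hvA : v ∈ A
    · exact h1.2.1 ⟨rfl, hvA⟩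
    · exact h2.2.2 ⟨rfl, hv, hvA⟩
  · intro u v hu hv h
    rw [mem_erase] at hu hv
    exact ⟨S.inner _ _ hu.2 hv.2 h, fun e => hu.1 e.1, fun e => hv.1 e.1⟩
  · intro u v hu hv h
    rw [mem_erase] at hu hv
    by_cases hvy : v = y
    · have : u ∈ A := by
        by_contra hcon
        exact h.2.2 ⟨hvy, hu.2, hcon⟩
      rw [hvy]; exact (hA u this).2
    · exact S.outD _ _ hu.2 (fun e => hv ⟨hvy, e⟩) h.1
  · intro u v hu hv h
    rw [mem_erase] at hu hv
    by_cases huy : u = y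
    · have hvU : v ∉ S.U := fun e => hv ⟨fun e' => h.ne (huy.trans e'.symm), e⟩
      rw [huy, hcy, hcr v hvU]
      exact (hp v hvU (huy ▸ h)).symm
    · have huU : u ∉ S.U := fun e => hu ⟨huy, e⟩
      by_cases hvy : v = y
      · rw [hvy, hcy, hcr u huU]
        exact hp u huU (hvy ▸ h.symm)
      · have hvU : v ∉ S.U := fun e => hv ⟨hvy, e⟩
        rw [hcr u huU, hcr v hvU]
        exact S.proper _ _ huU hvU h
  · intro u hu
    rw [mem_erase] at hu
    by_cases huy : u = y
    · rw [huy, hcy]; exact hs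
    · have huU : u ∉ S.U := fun e => hu ⟨huy, e⟩
      rw [hcr u huU]; exact S.bound u huU
  · exact hcr
  · exact hcu

/-- Decide an independent set all of whose members have the same count `s`. -/
theorem PSt.decideSet (S : PSt G D) (hD0 : ∀ u v, D u v → G.Adj u v) (s : ℕ) (hs : s ≤ 10)
    (K : Finset V) : K ⊆ S.U → (∀ x ∈ K, ∀ y ∈ K, ¬ G.Adj x y) → (∀ x ∈ K, S.c x = s) →
    (∀ x ∈ K, ∀ r, r ∉ S.U → G.Adj x r → S.c r ≠ s) →
    ∃ S' : PSt G D, S'.U = S.U \ K ∧ (∀ r, r ∉ S.U → S'.c r = S.c r) ∧ (∀ x ∈ K, S'.c x = s) ∧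
      (∀ u ∈ S.U, u ∉ K → S'.c u + (K.filter (G.Adj u)).card = S.c u) := by
  induction K using Finset.induction_on with
  | empty =>
    intro _ _ _ _
    exact ⟨S, by simp, fun _ _ => rfl, by simp, by simp⟩
  | insert x K hx ih =>
    intro h1 h2 h3 h4
    obtain ⟨S1, a1, a2, a3, a4⟩ := ih (fun z hz => h1 (mem_insert_of_mem hz))
      (fun u hu v hv => h2 u (mem_insert_of_mem hu) v (mem_insert_of_mem hv))
      (fun u hu => h3 u (mem_insert_of_mem hu)) (fun u hu => h4 u (mem_insert_of_mem hu))
    have hxU : x ∈ S.U := h1 (mem_insert_self _ _)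
    have hx1 : x ∈ S1.U := by rw [a1, mem_sdiff]; exact ⟨hxU, hx⟩
    have hcx : S1.c x = s := by
      have := a4 x hxU hx
      have h0 : K.filter (G.Adj x) = ∅ := by
        apply filter_eq_empty_iff.2
        intro z hz
        exact h2 x (mem_insert_self _ _) z (mem_insert_of_mem hz)
      rw [h0, card_empty, add_zero] at this
      rw [this]; exact h3 x (mem_insert_self _ _)
    obtain ⟨S2, b1, b2, b3, b4⟩ := S1.decide1 hD0 x hx1 ∅ (by simp) s hs (by simpa using hcx) (by
      intro r hr hxr
      rw [a1, mem_sdiff, not_and, not_not] at hr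
      by_cases hrU : r ∈ S.U
      · exact absurd hxr (h2 x (mem_insert_self _ _) r (mem_insert_of_mem (hr hrU)))
      · rw [a2 r hrU]; exact h4 x (mem_insert_self _ _) r hrU hxr)
    refine ⟨S2, ?_, ?_, ?_, ?_⟩
    · rw [b1, a1]; ext z; simp only [mem_erase, mem_sdiff, mem_insert]; tauto
    · intro r hr
      rw [b3 r (by rw [a1, mem_sdiff]; exact fun e => hr e.1), a2 r hr]
    · intro z hz
      rcases mem_insert.1 hz with rfl | hz
      · exact b2
      · rw [b3 z (by rw [a1, mem_sdiff]; exact fun e => e.2 hz), a3 z hz]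
    · intro u hu huK
      rw [mem_insert, not_or] at huK
      have e1 := a4 u hu huK.2
      have e2 := b4 u (by rw [a1, mem_sdiff]; exact ⟨hu, huK.2⟩) huK.1
      rw [filter_insert]
      by_cases had : G.Adj u x
      · rw [if_pos had, card_insert_of_notMem (fun e => hx (mem_filter.1 e).1)]
        simp only [had, notMem_empty, not_false_eq_true, and_self, if_true] at e2
        omega
      · rw [if_neg had]
        simp only [had, false_and, if_false] at e2
        omega

/-- The greedy finish. -/
theorem PSt.finish (hD0 : ∀ u v, D u v → G.Adj u v) : ∀ (n : ℕ) (S : PSt G D), S.U.card = n →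
    (∀ u ∈ S.U, S.c u ≤ 10) →
    (∀ u ∈ S.U, ∀ r, r ∉ S.U → G.Adj u r → S.c u < S.c r) → ∃ S' : PSt G D, S'.U = ∅ := by
  intro n
  induction n with
  | zero => intro S h _ _; exact ⟨S, card_eq_zero.1 h⟩
  | succ n ih =>
    intro S h hb hI
    have hne : S.U.Nonempty := by rw [← card_pos]; omega
    obtain ⟨x, hx, hmax⟩ := exists_max_image S.U S.c hne
    obtain ⟨S', b1, b2, b3, b4⟩ := S.decide1 hD0 x hx ∅ (by simp) (S.c x) (hb x hx) (by simp)
      (fun r hr hxr => (hI x hx r hr hxr).ne')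
    apply ih S'
    · rw [b1, card_erase_of_mem hx]; omega
    · intro u hu
      rw [b1, mem_erase] at hu
      have := b4 u hu.2 hu.1
      have := hb u hu.2
      omega
    · intro u hu r hr hur
      rw [b1, mem_erase] at hu hr
      have e := b4 u hu.2 hu.1
      by_cases hrx : r = x
      · subst hrx
        simp only [hur, notMem_empty, not_false_eq_true, and_self, if_true] at e
        have := hmax u hu.2
        omega
      · have hrU : r ∉ S.U := fun e => hr ⟨hrx, e⟩
        rw [b3 r hrU]
        have := hI u hu.2 r hrU hur
        omega

def PSt.InvA (S : PSt G D) (col : V → Fin 3) (s : ℕ) (j : Fin 3) (J : V → Prop)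
    (sk : Fin 3 → Prop) : Prop :=
  (∀ u ∈ S.U, ∀ r, r ∉ S.U → G.Adj u r → (J u → s < S.c r) ∧
    (col u ≠ j → s ≤ S.c r ∧ (¬ sk (col u) → S.c r = s → S.c u < s))) ∧
  (∀ u ∈ S.U, col u ≠ j → ¬ sk (col u) → S.c u ≤ s)

/-- Repeatedly decide eligible vertices of colour `j`. -/
theorem PSt.loopA (hD0 : ∀ u v, D u v → G.Adj u v) (col : V → Fin 3)
    (hcol : ∀ u v, G.Adj u v → col u ≠ col v) (s : ℕ) (hs : s ≤ 10) (j : Fin 3) (J : V → Prop)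
    (hJ : ∀ u, J u → col u = j) (sk : Fin 3 → Prop) :
    ∀ (n : ℕ) (S : PSt G D), S.U.card = n → S.InvA col s j J sk →
    ∃ S' : PSt G D, S'.InvA col s j J sk ∧ S'.U ⊆ S.U ∧ (∀ u ∈ S'.U, S'.c u ≤ S.c u) ∧
      (∀ u ∈ S'.U, col u = j → S'.c u = S.c u) ∧
      (∀ u ∈ S.U, u ∉ S'.U → J u ∧ S'.c u = s) ∧
      (∀ r, r ∉ S.U → S'.c r = S.c r) ∧
      (∀ y ∈ S'.U, J y → ∀ A : Finset V,
        (∀ v ∈ A, v ∈ S'.U ∧ D v y ∧ (sk (col v) ∨ S'.c v < s)) → S'.c y ≠ s + A.card) := by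
  intro n
  induction n with
  | zero =>
    intro S h hI
    have h0 := card_eq_zero.1 h
    refine ⟨S, hI, Subset.refl _, fun _ _ => le_rfl, fun _ _ _ => rfl,
      fun u hu hu' => absurd hu hu', fun _ _ => rfl, ?_⟩
    intro y hy; rw [h0] at hy; simp at hy
  | succ n ih =>
    intro S h hI
    by_cases hel : ∃ y ∈ S.U, J y ∧ ∃ A : Finset V,
        (∀ v ∈ A, v ∈ S.U ∧ D v y ∧ (sk (col v) ∨ S.c v < s)) ∧ S.c y = s + A.card
    · obtain ⟨y, hy, hJy, A, hA, hcy⟩ := hel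
      obtain ⟨S1, b1, b2, b3, b4⟩ := S.decide1 hD0 y hy A (fun v hv => ⟨(hA v hv).1, (hA v hv).2.1⟩)
        s hs hcy (fun r hr hyr => ((hI.1 y hy r hr hyr).1 hJy).ne')
      have hle : ∀ u ∈ S1.U, S1.c u ≤ S.c u := by
        intro u hu
        rw [b1, mem_erase] at hu
        have := b4 u hu.2 hu.1
        omega
      have hI1 : S1.InvA col s j J sk := by
        refine ⟨?_, ?_⟩
        · intro u hu r hr hur
          have hle' := hle u hu
          rw [b1, mem_erase] at hu hr
          by_cases hry : r = y
          · subst hry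
            refine ⟨fun hJu => absurd ((hJ u hJu).trans (hJ r hJy).symm) (hcol _ _ hur), ?_⟩
            intro huj
            refine ⟨b2.ge, fun hsk _ => ?_⟩
            have e := b4 u hu.2 hu.1
            by_cases huA : u ∈ A
            · rcases (hA u huA).2.2 with h' | h'
              · exact absurd h' hsk
              · omega
            · simp only [hur, huA, not_false_eq_true, and_self, if_true] at e
              have := hI.2 u hu.2 huj hsk
              omega
          · have hrU : r ∉ S.U := fun e => hr ⟨hry, e⟩
            have := hI.1 u hu.2 r hrU hur
            rw [b3 r hrU]
            refine ⟨this.1, fun huj => ⟨(this.2 huj).1, fun h1 h2 => ?_⟩⟩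
            have := (this.2 huj).2 h1 h2
            omega
        · intro u hu h1 h2
          have hle' := hle u hu
          rw [b1, mem_erase] at hu
          have := hI.2 u hu.2 h1 h2
          omega
      obtain ⟨S', c1, c2, c3, c4, c5, c6, c7⟩ := ih S1 (by rw [b1, card_erase_of_mem hy]; omega) hI1
      have hsub : S1.U ⊆ S.U := by rw [b1]; exact erase_subset _ _
      have hy1 : y ∉ S1.U := by rw [b1]; simp
      refine ⟨S', c1, c2.trans hsub, fun u hu => (c3 u hu).trans (hle u (c2 hu)), ?_, ?_, ?_, c7⟩
      · intro u hu huj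
        rw [c4 u hu huj]
        have hu1 := c2 hu
        rw [b1, mem_erase] at hu1
        have e := b4 u hu1.2 hu1.1
        have hna : ¬ G.Adj u y := fun h => hcol _ _ h (huj.trans (hJ y hJy).symm)
        simp only [hna, false_and, if_false] at e
        omega
      · intro u hu hu'
        by_cases huy : u = y
        · subst huy
          exact ⟨hJy, by rw [c6 u hy1, b2]⟩
        · exact c5 u (by rw [b1, mem_erase]; exact ⟨huy, hu⟩) hu'
      · intro r hr
        rw [c6 r (fun e => hr (hsub e)), b3 r hr]
    · push Not at hel
      exact ⟨S, hI, Subset.refl _, fun _ _ => le_rfl, fun _ _ _ => rfl,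
        fun u hu hu' => absurd hu hu', fun _ _ => rfl, hel⟩

/-- Consequence of not being eligible. -/
theorem PSt.inelig (S : PSt G D) (hD1 : ∀ u v, G.Adj u v → D u v ∨ D v u)
    (hD2 : ∀ u, (univ.filter (D u)).card ≤ 2) (P : V → Prop) (s : ℕ) (_hs : 2 ≤ s)
    (y : V) (hy : y ∈ S.U)
    (h : ∀ A : Finset V, (∀ v ∈ A, v ∈ S.U ∧ D v y ∧ P v) → S.c y ≠ s + A.card)
    (hc : s ≤ S.c y) :
    s < S.c y ∧ ∃ B : Finset V, (∀ v ∈ B, v ∈ S.U ∧ D v y ∧ ¬ P v) ∧ s ≤ B.card + 1 ∧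
      (S.c y = s + 1 → ∀ v ∈ S.U, D v y → ¬ P v) := by
  have h0 := h ∅ (by simp)
  simp only [card_empty, add_zero] at h0
  have h1 := S.c_le hD1 hD2 y hy
  have hg : ((S.din y).filter P).card < S.c y - s := by
    by_contra hcon
    obtain ⟨A, hA, hAc⟩ := exists_subset_card_eq (not_lt.1 hcon)
    refine h A ?_ (by omega)
    intro v hv
    have := mem_filter.1 (hA hv)
    have h2 := mem_filter.1 this.1
    exact ⟨h2.1, h2.2, this.2⟩
  have hsum : ((S.din y).filter P).card + ((S.din y).filter (fun v => ¬ P v)).card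
      = (S.din y).card := card_filter_add_card_filter_not _
  refine ⟨by omega, (S.din y).filter (fun v => ¬ P v), ?_, by omega, ?_⟩
  · intro v hv
    have := mem_filter.1 hv
    have h2 := mem_filter.1 this.1
    exact ⟨h2.1, h2.2, this.2⟩
  · intro he v hv hvy hP
    have : v ∈ (S.din y).filter P := mem_filter.2 ⟨mem_filter.2 ⟨hv, hvy⟩, hP⟩
    have := card_pos.2 ⟨v, this⟩
    omega

/-- Decide all vertices of colour `k` with count `s`. -/
theorem PSt.loopB (S : PSt G D) (hD0 : ∀ u v, D u v → G.Adj u v) (col : V → Fin 3)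
    (hcol : ∀ u v, G.Adj u v → col u ≠ col v) (s : ℕ) (hs : s ≤ 10) (k : Fin 3)
    (hp : ∀ x ∈ S.U, col x = k → S.c x = s → ∀ r, r ∉ S.U → G.Adj x r → S.c r ≠ s) :
    ∃ S' : PSt G D, S'.U ⊆ S.U ∧ (∀ u ∈ S'.U, col u = k → S.c u ≠ s) ∧
      (∀ u ∈ S.U, u ∉ S'.U → col u = k ∧ S'.c u = s) ∧
      (∀ r, r ∉ S.U → S'.c r = S.c r) ∧
      (∀ u ∈ S'.U, S'.c u ≤ S.c u) ∧
      (∀ u ∈ S'.U, ∀ x ∈ S.U, x ∉ S'.U → G.Adj u x → S'.c u < S.c u) ∧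
      (∀ u ∈ S'.U, ∀ B : Finset V, (∀ v ∈ B, v ∈ S.U ∧ col v = k ∧ S.c v = s ∧ G.Adj u v) →
        S'.c u + B.card ≤ S.c u) := by
  obtain ⟨S', a1, a2, a3, a4⟩ := S.decideSet hD0 s hs (S.U.filter (fun x => col x = k ∧ S.c x = s))
    (filter_subset _ _)
    (fun x hx y hy h => hcol _ _ h ((mem_filter.1 hx).2.1.trans (mem_filter.1 hy).2.1.symm))
    (fun x hx => (mem_filter.1 hx).2.2)
    (fun x hx => hp x (mem_filter.1 hx).1 (mem_filter.1 hx).2.1 (mem_filter.1 hx).2.2)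
  have hm : ∀ u, u ∈ S'.U ↔ u ∈ S.U ∧ ¬ (col u = k ∧ S.c u = s) := by
    intro u
    rw [a1, mem_sdiff, mem_filter]
    tauto
  have hB : (∀ u ∈ S'.U, ∀ B : Finset V,
      (∀ v ∈ B, v ∈ S.U ∧ col v = k ∧ S.c v = s ∧ G.Adj u v) → S'.c u + B.card ≤ S.c u) := by
    intro u hu B hB
    rw [a1, mem_sdiff] at hu
    have e := a4 u hu.1 hu.2
    have : B ⊆ (S.U.filter (fun x => col x = k ∧ S.c x = s)).filter (G.Adj u) := by
      intro v hv
      obtain ⟨h1, h2, h3, h4⟩ := hB v hv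
      exact mem_filter.2 ⟨mem_filter.2 ⟨h1, h2, h3⟩, h4⟩
    have := card_le_card this
    omega
  refine ⟨S', fun u hu => ((hm u).1 hu).1, fun u hu h1 h2 => ((hm u).1 hu).2 ⟨h1, h2⟩, ?_, a2,
    fun u hu => by simpa using hB u hu ∅ (by simp), ?_, hB⟩
  · intro u hu hu'
    have : col u = k ∧ S.c u = s := by
      by_contra hcon
      exact hu' ((hm u).2 ⟨hu, hcon⟩)
    exact ⟨this.1, a3 u (mem_filter.2 ⟨hu, this⟩)⟩
  · intro u hu x hx hx' hux
    have : col x = k ∧ S.c x = s := by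
      by_contra hcon
      exact hx' ((hm x).2 ⟨hx, hcon⟩)
    have := hB u hu {x} (by
      intro v hv
      rw [mem_singleton] at hv
      subst hv
      exact ⟨hx, this.1, this.2, hux⟩)
    simp only [card_singleton] at this
    omega

/-- Step R. -/
theorem PSt.stepR (S : PSt G D) (hD0 : ∀ u v, D u v → G.Adj u v)
    (hD1 : ∀ u v, G.Adj u v → D u v ∨ D v u)
    (hD2 : ∀ u, (univ.filter (D u)).card ≤ 2) (col : V → Fin 3)
    (hcol : ∀ u v, G.Adj u v → col u ≠ col v) (s : ℕ) (hs : s ≤ 10) (hs2 : 2 ≤ s) (j : Fin 3)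
    (hp : ∀ u ∈ S.U, ∀ r, r ∉ S.U → G.Adj u r → s < S.c r) :
    ∃ S' : PSt G D, S'.U ⊆ S.U ∧ (∀ u ∈ S'.U, S'.c u ≤ S.c u) ∧
      (∀ u ∈ S'.U, col u = j → S'.c u < s) ∧
      (∀ u ∈ S'.U, ∀ r, r ∉ S'.U → G.Adj u r → s ≤ S'.c r ∧ (col u = j → s < S'.c r)) := by
  obtain ⟨S', c1, c2, c3, c4, c5, c6, c7⟩ := PSt.loopA hD0 col hcol s hs j (fun u => col u = j)
    (fun _ h => h) (fun _ => True) _ S rfl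
    ⟨fun u hu r hr hur => ⟨fun _ => hp u hu r hr hur,
      fun _ => ⟨(hp u hu r hr hur).le, fun h => absurd trivial h⟩⟩,
      fun _ _ _ h => absurd trivial h⟩
  refine ⟨S', c2, c3, ?_, ?_⟩
  · intro y hy hyj
    by_contra hcon
    obtain ⟨_, B, hB, hBc, _⟩ := S'.inelig hD1 hD2 (fun v => True ∨ S'.c v < s) s hs2 y hy
      (c7 y hy hyj) (not_lt.1 hcon)
    have : B.Nonempty := card_pos.1 (by omega)
    obtain ⟨v, hv⟩ := this
    exact (hB v hv).2.2 (Or.inl trivial)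
  · intro u hu r hr hur
    have := c1.1 u hu r hr hur
    by_cases h : col u = j
    · exact ⟨(this.1 h).le, fun _ => this.1 h⟩
    · exact ⟨(this.2 h).1, fun h' => absurd h' h⟩

/-- Step Sk. -/
theorem PSt.stepSk (S : PSt G D) (hD0 : ∀ u v, D u v → G.Adj u v)
    (hD1 : ∀ u v, G.Adj u v → D u v ∨ D v u)
    (hD2 : ∀ u, (univ.filter (D u)).card ≤ 2) (col : V → Fin 3)
    (hcol : ∀ u v, G.Adj u v → col u ≠ col v) (s e : ℕ) (hs : s ≤ 10) (hes : e + 2 ≤ s)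
    (j i k : Fin 3) (hcov : ∀ x : Fin 3, x = j ∨ x = i ∨ x = k) (hki : k ≠ i) (hji : j ≠ i)
    (hkj : k ≠ j)
    (hp : ∀ u ∈ S.U, ∀ r, r ∉ S.U → G.Adj u r → s ≤ S.c r ∧ (col u ≠ i → s < S.c r))
    (hk : ∀ u ∈ S.U, col u = k → S.c u ≤ s) (hj : ∀ u ∈ S.U, col u = j → S.c u ≤ s + e) :
    ∃ S' : PSt G D, S'.U ⊆ S.U ∧ (∀ u ∈ S'.U, S'.c u ≤ S.c u) ∧
      (∀ u ∈ S'.U, col u ≠ i → S'.c u < s) ∧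
      (∀ u ∈ S'.U, ∀ r, r ∉ S'.U → G.Adj u r → s ≤ S'.c r) := by
  obtain ⟨S1, c1, c2, c3, c4, c5, c6, c7⟩ := PSt.loopA hD0 col hcol s hs j (fun u => col u = j)
    (fun _ h => h) (fun x => x = i) _ S rfl (by
      refine ⟨fun u hu r hr hur => ⟨fun h => (hp u hu r hr hur).2 (fun h' => hji (h.symm.trans h')),
        fun h => ⟨(hp u hu r hr hur).1, fun h1 h2 => ?_⟩⟩, fun u hu h1 h2 => ?_⟩
      · have := (hp u hu r hr hur).2 h1
        omega
      · rcases hcov (col u) with h | h | h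
        · exact absurd h h1
        · exact absurd h h2
        · exact hk u hu h)
  obtain ⟨S2, d1, d2, d3, d4, d5, d6, d7⟩ := S1.loopB hD0 col hcol s hs k (by
    intro x hx hxk hxs r hr hxr h
    have := ((c1.1 x hx r hr hxr).2 (by rw [hxk]; exact hkj)).2 (by rw [hxk]; exact hki) h
    omega)
  refine ⟨S2, d1.trans c2, fun u hu => (d5 u hu).trans (c3 u (d1 hu)), ?_, ?_⟩
  · intro y hy hyi
    have hle := d5 y hy
    rcases hcov (col y) with h | h | h
    · by_contra hcon
      obtain ⟨_, B, hB, hBc, _⟩ := S1.inelig hD1 hD2 (fun v => col v = i ∨ S1.c v < s) s (by omega)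
        y (d1 hy) (c7 y (d1 hy) h) (by omega)
      have e1 := d7 y hy B (by
        intro v hv
        obtain ⟨h1, h2, h3⟩ := hB v hv
        rw [not_or] at h3
        have hvk : col v = k := by
          rcases hcov (col v) with h' | h' | h'
          · exact absurd (h'.trans h.symm) (hcol _ _ (hD0 _ _ h2))
          · exact absurd h' h3.1
          · exact h'
        refine ⟨h1, hvk, ?_, (hD0 _ _ h2).symm⟩
        have := c1.2 v h1 (by rw [hvk]; exact hkj) (by rw [hvk]; exact hki)
        omega)
      have e2 := c3 y (d1 hy)
      have e3 := hj y (c2 (d1 hy)) h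
      omega
    · exact absurd h hyi
    · have e1 := d2 y hy h
      have e2 := c1.2 y (d1 hy) (by rw [h]; exact hkj) (by rw [h]; exact hki)
      omega
  · intro u hu r hr hur
    by_cases hr1 : r ∈ S1.U
    · exact (d3 r hr1 hr).2.ge
    · rw [d4 r hr1]
      have := c1.1 u (d1 hu) r hr1 hur
      by_cases h : col u = j
      · exact (this.1 h).le
      · exact (this.2 h).1

theorem fin3_cases (x : Fin 3) : x = 0 ∨ x = 1 ∨ x = 2 := by
  revert x; decide

/-- The initial state: nothing is decided. -/
def PSt.start (G : SimpleGraph V) (D : V → V → Prop) : PSt G D where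
  U := univ
  o := G.Adj
  o_adj := fun _ _ h => h
  adj_o := fun _ _ h => Or.inl h
  both := fun _ _ _ _ => mem_univ _
  inner := fun _ _ _ _ h => h
  outD := fun _ v _ h => absurd (mem_univ v) h
  proper := fun u _ h => absurd (mem_univ u) h
  bound := fun u h => absurd (mem_univ u) h

theorem PSt.chain (hD0 : ∀ u v, D u v → G.Adj u v)
    (hD1 : ∀ u v, G.Adj u v → D u v ∨ D v u)
    (hD2 : ∀ u, (univ.filter (D u)).card ≤ 2) (col : V → Fin 3)
    (hcol : ∀ u v, G.Adj u v → col u ≠ col v) :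
    ∃ S : PSt G D, (∀ u ∈ S.U, ∀ r, r ∉ S.U → G.Adj u r → 5 ≤ S.c r) ∧
      (∀ u ∈ S.U, col u ≠ 0 → S.c u ≤ 4) ∧ (∀ u ∈ S.U, S.c u ≤ 5) := by
  obtain ⟨S1, a1, a2, a3, a4⟩ := (PSt.start G D).stepR hD0 hD1 hD2 col hcol 10 (by norm_num)
    (by norm_num) 2 (fun u _ r hr => absurd (mem_univ r) hr)
  obtain ⟨S2, b1, b2, b3, b4⟩ := S1.stepR hD0 hD1 hD2 col hcol 9 (by norm_num)
    (by norm_num) 1 (fun u hu r hr h => by have := (a4 u hu r hr h).1; omega)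
  obtain ⟨S3, c1, c2, c3, c4⟩ := S2.stepSk hD0 hD1 hD2 col hcol 8 1 (by norm_num)
    (by norm_num) 2 0 1 (by decide) (by decide) (by decide) (by decide)
    (fun u hu r hr h => by have := (b4 u hu r hr h).1; exact ⟨by omega, fun _ => by omega⟩)
    (fun u hu h => by have := b3 u hu h; omega)
    (fun u hu h => by have := a3 u (b1 hu) h; have := b2 u hu; omega)
  obtain ⟨S4, d1, d2, d3, d4⟩ := S3.stepR hD0 hD1 hD2 col hcol 7 (by norm_num)
    (by norm_num) 0 (fun u hu r hr h => by have := c4 u hu r hr h; omega)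
  obtain ⟨S5, e1, e2, e3, e4⟩ := S4.stepSk hD0 hD1 hD2 col hcol 6 1 (by norm_num)
    (by norm_num) 1 2 0 (by decide) (by decide) (by decide) (by decide)
    (fun u hu r hr h => by have := (d4 u hu r hr h).1; exact ⟨by omega, fun _ => by omega⟩)
    (fun u hu h => by have := d3 u hu h; omega)
    (fun u hu h => by
      have := c3 u (d1 hu) (by rw [h]; decide); have := d2 u hu; omega)
  obtain ⟨S6, f1, f2, f3, f4⟩ := S5.stepSk hD0 hD1 hD2 col hcol 5 2 (by norm_num)
    (by norm_num) 2 0 1 (by decide) (by decide) (by decide) (by decide)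
    (fun u hu r hr h => by have := e4 u hu r hr h; exact ⟨by omega, fun _ => by omega⟩)
    (fun u hu h => by have := e3 u hu (by rw [h]; decide); omega)
    (fun u hu h => by
      have := c3 u (d1 (e1 hu)) (by rw [h]; decide)
      have := d2 u (e1 hu)
      have := e2 u hu
      omega)
  refine ⟨S6, f4, fun u hu h => by have := f3 u hu h; omega, fun u hu => ?_⟩
  by_cases h : col u = 0
  · have := e3 u (f1 hu) (by rw [h]; decide)
    have := f2 u hu
    omega
  · have := f3 u hu h
    omega

/-- Steps 1 and 2 of the final phase. -/
theorem PSt.final1 (S : PSt G D) (hD0 : ∀ u v, D u v → G.Adj u v)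
    (hD1 : ∀ u v, G.Adj u v → D u v ∨ D v u)
    (hD2 : ∀ u, (univ.filter (D u)).card ≤ 2) (col : V → Fin 3)
    (hcol : ∀ u v, G.Adj u v → col u ≠ col v)
    (h1 : ∀ u ∈ S.U, ∀ r, r ∉ S.U → G.Adj u r → 5 ≤ S.c r)
    (h2 : ∀ u ∈ S.U, col u ≠ 0 → S.c u ≤ 4) (h3 : ∀ u ∈ S.U, S.c u ≤ 5) :
    ∃ S' : PSt G D, (∀ u ∈ S'.U, ∀ r, r ∉ S'.U → G.Adj u r → 4 ≤ S'.c r ∧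
        (col u ≠ 0 → S'.c r = 4 → S'.c u < 4)) ∧
      (∀ u ∈ S'.U, col u = 1 → S'.c u ≤ 3) ∧ (∀ u ∈ S'.U, col u = 2 → S'.c u ≤ 4) ∧
      (∀ u ∈ S'.U, col u = 0 → S'.c u ≤ 3 ∨ (S'.c u ≤ 5 ∧ (∀ v ∈ S'.U, D v u → col v = 2) ∧
        (S'.c u = 5 → ∀ r, r ∉ S'.U → G.Adj u r → 4 < S'.c r))) := by
  obtain ⟨S1, c1, c2, c3, c4, c5, c6, c7⟩ := PSt.loopA hD0 col hcol 4 (by norm_num) 0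
    (fun u => col u = 0) (fun _ h => h) (fun _ => False) _ S rfl (by
      refine ⟨fun u hu r hr hur => ⟨fun h => h1 u hu r hr hur,
        fun h => ⟨?_, fun _ h2 => ?_⟩⟩, fun u hu h _ => h2 u hu h⟩
      · have := h1 u hu r hr hur; omega
      · have := h1 u hu r hr hur; omega)
  have hc1 : ∀ u ∈ S1.U, col u ≠ 0 → S1.c u ≤ 4 := fun u hu h => c1.2 u hu h (fun h => h)
  obtain ⟨S2, d1, d2, d3, d4, d5, d6, d7⟩ := S1.loopB hD0 col hcol 4 (by norm_num) 1 (by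
    intro x hx hxk hxs r hr hxr h
    have := ((c1.1 x hx r hr hxr).2 (by rw [hxk]; decide)).2 (fun h => h) h
    omega)
  refine ⟨S2, ?_, ?_, ?_, ?_⟩
  · intro u hu r hr hur
    have hle := d5 u hu
    by_cases hr1 : r ∈ S1.U
    · refine ⟨(d3 r hr1 hr).2.ge, fun h _ => ?_⟩
      have := d6 u hu r hr1 hr hur
      have := hc1 u (d1 hu) h
      omega
    · rw [d4 r hr1]
      have := c1.1 u (d1 hu) r hr1 hur
      by_cases h : col u = 0
      · exact ⟨(this.1 h).le, fun h' => absurd h h'⟩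
      · refine ⟨(this.2 h).1, fun _ h' => ?_⟩
        have := (this.2 h).2 (fun h => h) h'
        omega
  · intro u hu h
    have := d2 u hu h
    have := hc1 u (d1 hu) (by rw [h]; decide)
    have := d5 u hu
    omega
  · intro u hu h
    have := hc1 u (d1 hu) (by rw [h]; decide)
    have := d5 u hu
    omega
  · intro y hy h
    have hle := d5 y hy
    by_cases hlt : S1.c y < 4
    · left; omega
    · right
      obtain ⟨h5, B, _, _, hall⟩ := S1.inelig hD1 hD2 (fun v => False ∨ S1.c v < 4) 4 (by omega)
        y (d1 hy) (c7 y (d1 hy) h) (by omega)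
      have hy5 : S1.c y ≤ 5 := (c3 y (d1 hy)).trans (h3 y (c2 (d1 hy)))
      have hy5' : S1.c y = 4 + 1 := by omega
      refine ⟨by omega, ?_, ?_⟩
      · intro v hv hvy
        have hn := hall hy5' v (d1 hv) hvy
        simp only [false_or, not_lt] at hn
        have hv0 : col v ≠ 0 := fun e => hcol _ _ (hD0 _ _ hvy) (e.trans h.symm)
        have := hc1 v (d1 hv) hv0
        rcases fin3_cases (col v) with e | e | e
        · exact absurd e hv0
        · have := d2 v hv e
          omega
        · exact e
      · intro he r hr hyr
        by_cases hr1 : r ∈ S1.U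
        · have := d6 y hy r hr1 hr hyr
          omega
        · rw [d4 r hr1]
          exact (c1.1 y (d1 hy) r hr1 hyr).1 h

/-- Steps 3 and 4 of the final phase. -/
theorem PSt.final2 (S : PSt G D) (hD0 : ∀ u v, D u v → G.Adj u v)
    (hD1 : ∀ u v, G.Adj u v → D u v ∨ D v u)
    (hD2 : ∀ u, (univ.filter (D u)).card ≤ 2) (col : V → Fin 3)
    (hcol : ∀ u v, G.Adj u v → col u ≠ col v)
    (h1 : ∀ u ∈ S.U, ∀ r, r ∉ S.U → G.Adj u r → 4 ≤ S.c r ∧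
        (col u ≠ 0 → S.c r = 4 → S.c u < 4))
    (h2 : ∀ u ∈ S.U, col u = 1 → S.c u ≤ 3) (h3 : ∀ u ∈ S.U, col u = 2 → S.c u ≤ 4)
    (h4 : ∀ u ∈ S.U, col u = 0 → S.c u ≤ 3 ∨ (S.c u ≤ 5 ∧ (∀ v ∈ S.U, D v u → col v = 2) ∧
        (S.c u = 5 → ∀ r, r ∉ S.U → G.Adj u r → 4 < S.c r))) :
    ∃ S' : PSt G D, (∀ u ∈ S'.U, ∀ r, r ∉ S'.U → G.Adj u r → 4 ≤ S'.c r) ∧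
      (∀ u ∈ S'.U, col u ≠ 0 → S'.c u ≤ 3) ∧
      (∀ u ∈ S'.U, col u = 0 → S'.c u ≤ 3 ∨ (S'.c u = 4 ∧ (∀ v ∈ S'.U, D v u → col v = 2))) := by
  obtain ⟨S1, c1, c2, c3, c4, c5, c6, c7⟩ := PSt.loopA hD0 col hcol 4 (by norm_num) 0
    (fun u => col u = 0 ∧ S.c u = 5) (fun _ h => h.1) (fun _ => False) _ S rfl (by
      refine ⟨fun u hu r hr hur => ⟨fun h => ?_,
        fun h => ⟨(h1 u hu r hr hur).1, fun _ h2 => (h1 u hu r hr hur).2 h h2⟩⟩,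
        fun u hu h _ => ?_⟩
      · rcases h4 u hu h.1 with h' | h'
        · omega
        · exact h'.2.2 h.2 r hr hur
      · rcases fin3_cases (col u) with e | e | e
        · exact absurd e h
        · have := h2 u hu e; omega
        · exact h3 u hu e)
  obtain ⟨S2, d1, d2, d3, d4, d5, d6, d7⟩ := S1.loopB hD0 col hcol 4 (by norm_num) 2 (by
    intro x hx hxk hxs r hr hxr h
    have := ((c1.1 x hx r hr hxr).2 (by rw [hxk]; decide)).2 (fun h => h) h
    omega)
  refine ⟨S2, ?_, ?_, ?_⟩
  · intro u hu r hr hur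
    by_cases hr1 : r ∈ S1.U
    · exact (d3 r hr1 hr).2.ge
    · rw [d4 r hr1]
      by_cases hr0 : r ∈ S.U
      · exact (c5 r hr0 hr1).2.ge
      · rw [c6 r hr0]
        exact (h1 u (c2 (d1 hu)) r hr0 hur).1
  · intro u hu h
    have e1 := d5 u hu
    have e2 := c3 u (d1 hu)
    rcases fin3_cases (col u) with e | e | e
    · exact absurd e h
    · have := h2 u (c2 (d1 hu)) e; omega
    · have := h3 u (c2 (d1 hu)) e
      have := d2 u hu e
      omega
  · intro y hy h
    have hle := d5 y hy
    have heq := c4 y (d1 hy) h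
    rcases h4 y (c2 (d1 hy)) h with h' | ⟨h5, h6, -⟩
    · left; omega
    · by_cases h55 : S.c y = 5
      · left
        obtain ⟨_, B, hB, hBc, _⟩ := S1.inelig hD1 hD2 (fun v => False ∨ S1.c v < 4) 4 (by omega)
          y (d1 hy) (c7 y (d1 hy) ⟨h, h55⟩) (by omega)
        have := d7 y hy B (by
          intro v hv
          obtain ⟨g1, g2, g3⟩ := hB v hv
          simp only [false_or, not_lt] at g3
          have hv2 := h6 v (c2 g1) g2
          refine ⟨g1, hv2, ?_, (hD0 _ _ g2).symm⟩
          have := h3 v (c2 g1) hv2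
          have := c3 v g1
          omega)
        omega
      · by_cases h33 : S2.c y ≤ 3
        · exact Or.inl h33
        · exact Or.inr ⟨by omega, fun v hv hvy => h6 v (c2 (d1 hv)) hvy⟩

/-- Steps 5 and 6 of the final phase. -/
theorem PSt.final3 (S : PSt G D) (hD0 : ∀ u v, D u v → G.Adj u v)
    (hD1 : ∀ u v, G.Adj u v → D u v ∨ D v u)
    (hD2 : ∀ u, (univ.filter (D u)).card ≤ 2) (col : V → Fin 3)
    (hcol : ∀ u v, G.Adj u v → col u ≠ col v)
    (h1 : ∀ u ∈ S.U, ∀ r, r ∉ S.U → G.Adj u r → 4 ≤ S.c r)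
    (h2 : ∀ u ∈ S.U, col u ≠ 0 → S.c u ≤ 3)
    (h4 : ∀ u ∈ S.U, col u = 0 → S.c u ≤ 3 ∨ (S.c u = 4 ∧ (∀ v ∈ S.U, D v u → col v = 2))) :
    ∃ S' : PSt G D, (∀ u ∈ S'.U, S'.c u ≤ 10) ∧
      (∀ u ∈ S'.U, ∀ r, r ∉ S'.U → G.Adj u r → S'.c u < S'.c r) := by
  obtain ⟨S1, c1, c2, c3, c4, c5, c6, c7⟩ := PSt.loopA hD0 col hcol 3 (by norm_num) 0
    (fun u => col u = 0 ∧ S.c u = 4) (fun _ h => h.1) (fun _ => False) _ S rfl (by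
      refine ⟨fun u hu r hr hur => ⟨fun h => h1 u hu r hr hur,
        fun h => ⟨?_, fun _ h2 => ?_⟩⟩, fun u hu h _ => h2 u hu h⟩
      · have := h1 u hu r hr hur; omega
      · have := h1 u hu r hr hur; omega)
  obtain ⟨S2, d1, d2, d3, d4, d5, d6, d7⟩ := S1.loopB hD0 col hcol 3 (by norm_num) 2 (by
    intro x hx hxk hxs r hr hxr h
    have := ((c1.1 x hx r hr hxr).2 (by rw [hxk]; decide)).2 (fun h => h) h
    omega)
  have hcases : ∀ u ∈ S2.U, S1.c u ≤ 3 ∨ S2.c u ≤ 2 := by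
    intro y hy
    by_cases h : col y = 0
    · have heq := c4 y (d1 hy) h
      rcases h4 y (c2 (d1 hy)) h with h' | ⟨h5, h6⟩
      · left; omega
      · right
        obtain ⟨_, B, hB, hBc, _⟩ := S1.inelig hD1 hD2 (fun v => False ∨ S1.c v < 3) 3 (by omega)
          y (d1 hy) (c7 y (d1 hy) ⟨h, h5⟩) (by omega)
        have := d7 y hy B (by
          intro v hv
          obtain ⟨g1, g2, g3⟩ := hB v hv
          simp only [false_or, not_lt] at g3
          have hv2 := h6 v (c2 g1) g2
          refine ⟨g1, hv2, ?_, (hD0 _ _ g2).symm⟩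
          have := h2 v (c2 g1) (by rw [hv2]; decide)
          have := c3 v g1
          omega)
        omega
    · left
      have := h2 y (c2 (d1 hy)) h
      have := c3 y (d1 hy)
      omega
  refine ⟨S2, ?_, ?_⟩
  · intro u hu
    have := d5 u hu
    rcases hcases u hu with h | h <;> omega
  · intro u hu r hr hur
    have hle := d5 u hu
    have hcs := hcases u hu
    by_cases hr1 : r ∈ S1.U
    · have e1 := (d3 r hr1 hr).2
      have e2 := d6 u hu r hr1 hr hur
      omega
    · rw [d4 r hr1]
      by_cases h : col u = 0
      · have hr0 : r ∉ S.U := fun hr0 =>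
          hcol _ _ hur (h.trans (c5 r hr0 hr1).1.1.symm)
        rw [c6 r hr0]
        have := h1 u (c2 (d1 hu)) r hr0 hur
        omega
      · have e1 := (c1.1 u (d1 hu) r hr1 hur).2 h
        have e2 := e1.2 (fun h => h)
        have e3 := h2 u (c2 (d1 hu)) h
        have e4 := c3 u (d1 hu)
        omega

theorem exists_orientation (hD0 : ∀ u v, D u v → G.Adj u v)
    (hD1 : ∀ u v, G.Adj u v → D u v ∨ D v u)
    (hD2 : ∀ u, (univ.filter (D u)).card ≤ 2) (col : V → Fin 3)
    (hcol : ∀ u v, G.Adj u v → col u ≠ col v) :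
    ∃ o : GOrientation G, o.IsProper ∧ ∀ u, o.outDeg u ≤ 10 := by
  obtain ⟨S1, a1, a2, a3⟩ := PSt.chain hD0 hD1 hD2 col hcol
  obtain ⟨S2, b1, b2, b3, b4⟩ := S1.final1 hD0 hD1 hD2 col hcol a1 a2 a3
  obtain ⟨S3, c1, c2, c3⟩ := S2.final2 hD0 hD1 hD2 col hcol b1 b2 b3 b4
  obtain ⟨S4, d1, d2⟩ := S3.final3 hD0 hD1 hD2 col hcol c1 c2 c3
  obtain ⟨S, hS⟩ := PSt.finish hD0 _ S4 rfl d1 d2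
  have hU : ∀ u, u ∉ S.U := fun u => by rw [hS]; simp
  let o : GOrientation G :=
    { dir := fun u v => decide (S.o u v)
      adj_iff := by
        intro u v
        simp only [decide_eq_true_eq]
        exact ⟨S.adj_o u v, fun h => h.elim (S.o_adj u v) (fun h => (S.o_adj v u h).symm)⟩
      not_both := by
        intro u v h
        simp only [decide_eq_true_eq] at h
        exact hU u (S.both u v h.1 h.2) }
  have ho : ∀ u, o.outDeg u = ocnt S.o u := by
    intro u
    unfold GOrientation.outDeg ocnt
    congr 1
    ext v
    simp [mem_oset, o]
  refine ⟨o, ?_, ?_⟩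
  · intro u v h
    rw [ho, ho]
    exact S.proper u v (hU u) (hU v) h
  · intro u
    rw [ho]
    exact S.bound u (hU u)

end states


/-! ### Degeneracy from the excluded `K₄` minor -/
section degen
open Classical

variable {V : Type*} {G : SimpleGraph V}

theorem seg_connected (p : ℕ → V) (l r : ℕ) (hlr : l ≤ r)
    (hadj : ∀ i, l ≤ i → i < r → G.Adj (p i) (p (i + 1))) :
    (G.induce (p '' Set.Icc l r)).Connected := by
  have key : ∀ i (h1 : l ≤ i) (h2 : i ≤ r),
      (G.induce (p '' Set.Icc l r)).Reachable ⟨p l, l, ⟨le_refl _, hlr⟩, rfl⟩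
        ⟨p i, i, ⟨h1, h2⟩, rfl⟩ := by
    intro i h1
    induction i, h1 using Nat.le_induction with
    | base => intro _; exact SimpleGraph.Reachable.refl _
    | succ i hi ih =>
      intro h2
      refine (ih (by omega)).trans (SimpleGraph.Adj.reachable ?_)
      exact hadj i hi (by omega)
  rw [SimpleGraph.connected_iff_exists_forall_reachable]
  refine ⟨⟨p l, l, ⟨le_refl _, hlr⟩, rfl⟩, ?_⟩
  rintro ⟨_, i, hi, rfl⟩
  exact key i hi.1 hi.2

/-- `p` restricted to `0..m` is a path inside `W`. -/
def IsP (G : SimpleGraph V) (W : Finset V) (m : ℕ) (p : ℕ → V) : Prop :=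
  (∀ i, i ≤ m → p i ∈ W) ∧ (∀ i j, i ≤ m → j ≤ m → p i = p j → i = j) ∧
    ∀ i, i < m → G.Adj (p i) (p (i + 1))

theorem k4_of_cross (W : Finset V) (m : ℕ) (p : ℕ → V) (hp : IsP G W m p) (a j t : ℕ)
    (ha : 2 ≤ a) (haj : a < j) (hat : a < t) (hjm : j ≤ m) (htm : t ≤ m)
    (h1 : G.Adj (p 0) (p a)) (h2 : G.Adj (p 0) (p j)) (h3 : G.Adj (p (a - 1)) (p t)) :
    HasMinor G (completeGraph (Fin 4)) := by
  obtain ⟨hpW, hinj, hadj⟩ := hp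
  let L : Fin 4 → ℕ := ![0, a - 1, a, min t j]
  let R : Fin 4 → ℕ := ![a - 2, a - 1, min t j - 1, max t j]
  have hLR : ∀ w, L w ≤ R w := by
    intro w; fin_cases w <;> simp [L, R] <;> omega
  have hRm : ∀ w, R w ≤ m := by
    intro w; fin_cases w <;> simp [R] <;> omega
  have hsep : ∀ w₁ w₂, w₁ < w₂ → R w₁ < L w₂ := by
    intro w₁ w₂ h
    fin_cases w₁ <;> fin_cases w₂ <;> simp [L, R] at h ⊢ <;> omega
  have hed : ∀ w₁ w₂, w₁ < w₂ → ∃ i k, L w₁ ≤ i ∧ i ≤ R w₁ ∧ L w₂ ≤ k ∧ k ≤ R w₂ ∧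
      G.Adj (p i) (p k) := by
    have e1 := hadj (a - 2) (by omega)
    rw [show a - 2 + 1 = a - 1 by omega] at e1
    have e2 := hadj (a - 1) (by omega)
    rw [show a - 1 + 1 = a by omega] at e2
    have e3 := hadj (min t j - 1) (by omega)
    rw [show min t j - 1 + 1 = min t j by omega] at e3
    intro w₁ w₂ h
    fin_cases w₁ <;> fin_cases w₂ <;> simp [L, R] at h ⊢
    · exact ⟨a - 2, by omega, a - 1, by omega, by omega, e1⟩
    · exact ⟨0, by omega, a, by omega, by omega, h1⟩
    · exact ⟨0, by omega, j, by omega, by omega, h2⟩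
    · exact ⟨a - 1, by omega, by omega, a, by omega, by omega, e2⟩
    · exact ⟨a - 1, by omega, by omega, t, by omega, by omega, h3⟩
    · exact ⟨min t j - 1, by omega, by omega, min t j, by omega, by omega, e3⟩
  have hdis : ∀ w₁ w₂, w₁ < w₂ →
      Disjoint (p '' Set.Icc (L w₁) (R w₁)) (p '' Set.Icc (L w₂) (R w₂)) := by
    intro w₁ w₂ h
    rw [Set.disjoint_left]
    rintro _ ⟨i, hi, rfl⟩ ⟨k, hk, hik⟩
    have := hinj k i (hk.2.trans (hRm _)) (hi.2.trans (hRm _)) hik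
    have := hsep _ _ h
    have := hi.2
    have := hk.1
    omega
  refine ⟨fun w => p '' Set.Icc (L w) (R w), ?_, ?_, ?_, ?_⟩
  · intro w; exact ⟨p (L w), L w, ⟨le_refl _, hLR w⟩, rfl⟩
  · intro w
    exact seg_connected p _ _ (hLR w) (fun i _ h => hadj i (lt_of_lt_of_le h (hRm w)))
  · intro w₁ w₂ h
    rcases lt_or_gt_of_ne h with h | h
    · exact hdis _ _ h
    · exact (hdis _ _ h).symm
  · intro w₁ w₂ h
    rcases lt_or_gt_of_ne h.ne with h | h
    · obtain ⟨i, k, a1, a2, a3, a4, a5⟩ := hed _ _ h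
      exact ⟨p i, ⟨i, ⟨a1, a2⟩, rfl⟩, p k, ⟨k, ⟨a3, a4⟩, rfl⟩, a5⟩
    · obtain ⟨i, k, a1, a2, a3, a4, a5⟩ := hed _ _ h
      exact ⟨p k, ⟨k, ⟨a3, a4⟩, rfl⟩, p i, ⟨i, ⟨a1, a2⟩, rfl⟩, a5.symm⟩

/-- In a longest path all neighbours of the end vertex lie on the path. -/
theorem nbr_on_path (W : Finset V) (m : ℕ) (hmax : ∀ q, ¬ IsP G W (m + 1) q) (p : ℕ → V)
    (hp : IsP G W m p) (x : V) (hx : x ∈ W) (hadj : G.Adj (p 0) x) :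
    ∃ i, i ≤ m ∧ p i = x := by
  by_contra hcon
  push Not at hcon
  apply hmax (fun i => if i = 0 then x else p (i - 1))
  refine ⟨?_, ?_, ?_⟩
  · intro i hi
    by_cases h : i = 0
    · simpa [h] using hx
    · simpa [h] using hp.1 (i - 1) (by omega)
  · intro i j hi hj h
    by_cases h0 : i = 0 <;> by_cases h1 : j = 0 <;> simp only [h0, h1, if_true, if_false] at h ⊢
    · exact absurd h.symm (hcon _ (by omega))
    · exact absurd h (hcon _ (by omega))
    · have := hp.2.1 _ _ (by omega) (by omega) h
      omega
  · intro i hi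
    by_cases h0 : i = 0
    · subst h0; simpa using hadj.symm
    · have := hp.2.2 (i - 1) (by omega)
      rw [show i - 1 + 1 = i by omega] at this
      simpa [h0] using this

theorem third_nbr (W : Finset V) (hdeg : ∀ v ∈ W, 3 ≤ (W.filter (G.Adj v)).card) (v : V)
    (hv : v ∈ W) (x y : V) : ∃ z ∈ W, G.Adj v z ∧ z ≠ x ∧ z ≠ y := by
  by_contra hcon
  push Not at hcon
  have : W.filter (G.Adj v) ⊆ {x, y} := by
    intro z hz
    rw [mem_filter] at hz
    simp only [mem_insert, mem_singleton]
    by_contra h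
    push Not at h
    exact h.2 (hcon z hz.1 hz.2 h.1)
  have h1 := card_le_card this
  have h2 := card_le_two (a := x) (b := y)
  have h3 := hdeg v hv
  omega

theorem k4_main (W : Finset V) (hdeg : ∀ v ∈ W, 3 ≤ (W.filter (G.Adj v)).card) (m : ℕ)
    (hmax : ∀ q, ¬ IsP G W (m + 1) q) : ∀ a : ℕ, ∀ p, IsP G W m p → ∀ j, 2 ≤ a → a < j → j ≤ m →
    G.Adj (p 0) (p a) → G.Adj (p 0) (p j) → HasMinor G (completeGraph (Fin 4)) := by
  intro a
  induction a using Nat.strong_induction_on with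
  | _ a ih =>
  intro p hp j ha haj hjm h1 h2
  -- the rotated path
  let q : ℕ → V := fun i => if i < a then p (a - 1 - i) else p i
  have hq : IsP G W m q := by
    refine ⟨?_, ?_, ?_⟩
    · intro i hi
      by_cases h : i < a <;> simp only [q, h, if_true, if_false] <;> apply hp.1 <;> omega
    · intro i k hi hk h
      by_cases h0 : i < a <;> by_cases h1 : k < a <;>
        simp only [q, h0, h1, if_true, if_false] at h <;>
        have := hp.2.1 _ _ (by omega) (by omega) h <;> omega
    · intro i hi
      by_cases h0 : i + 1 < a
      · have h3 : i < a := by omega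
        simp only [q, h0, h3, if_true]
        have := hp.2.2 (a - 1 - (i + 1)) (by omega)
        rw [show a - 1 - (i + 1) + 1 = a - 1 - i by omega] at this
        exact this.symm
      · by_cases h3 : i < a
        · have h4 : i = a - 1 := by omega
          simp only [q, h0, h3, if_true, if_false]
          rw [h4, show a - 1 - (a - 1) = 0 by omega, show a - 1 + 1 = a by omega]
          exact h1
        · simp only [q, h0, h3, if_false]
          exact hp.2.2 i hi
  have hq0 : q 0 = p (a - 1) := by
    have : 0 < a := by omega
    simp [q, this]
  obtain ⟨z, hz, hz1, hz2, hz3⟩ := third_nbr W hdeg (p (a - 1)) (hp.1 _ (by omega)) (p a) (p (a - 2))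
  obtain ⟨i, him, hi⟩ := nbr_on_path W m hmax q hq z hz (by rw [hq0]; exact hz1)
  have hqa : q a = p a := by simp [q]
  have hadja : G.Adj (q 0) (q a) := by
    rw [hq0, hqa]
    have := hp.2.2 (a - 1) (by omega)
    rwa [show a - 1 + 1 = a by omega] at this
  by_cases hia : i < a
  · have hi0 : i ≠ 0 := by
      rintro rfl
      rw [hq0] at hi
      exact hz1.ne hi
    have hi1 : i ≠ 1 := by
      rintro rfl
      apply hz3
      rw [← hi]
      simp only [q, hia, if_true]
      congr 1
    exact ih i hia q hq a (by omega) hia (by omega) (by rw [hq0, hi]; exact hz1) hadja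
  · have hqi : q i = p i := by simp [q, hia]
    have hne : i ≠ a := by
      rintro rfl
      exact hz2 (by rw [← hi, hqi])
    exact k4_of_cross W m p hp a j i ha haj (by omega) hjm him h1 h2 (by rw [← hqi, hi]; exact hz1)

theorem exists_low_degree [Fintype V] (hG : ¬ HasMinor G (completeGraph (Fin 4))) (W : Finset V)
    (hW : W.Nonempty) : ∃ v ∈ W, (W.filter (G.Adj v)).card ≤ 2 := by
  by_contra hcon
  push Not at hcon
  have hdeg : ∀ v ∈ W, 3 ≤ (W.filter (G.Adj v)).card := fun v hv => hcon v hv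
  have hbd : ∀ m p, IsP G W m p → m < Fintype.card V + 1 := by
    intro m p hp
    have := Fintype.card_le_of_injective (fun i : Fin (m + 1) => p i) (by
      intro i j h
      exact Fin.ext (hp.2.1 _ _ (by omega) (by omega) h))
    simp at this
    omega
  obtain ⟨v, hv⟩ := hW
  have h0 : ∃ p, IsP G W 0 p := ⟨fun _ => v, fun _ _ => hv, fun i j _ _ _ => by omega, fun i hi => by omega⟩
  obtain ⟨m, ⟨p, hp⟩, hmax⟩ : ∃ m, (∃ p, IsP G W m p) ∧ ∀ q, ¬ IsP G W (m + 1) q := by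
    by_contra hc
    push Not at hc
    have : ∀ m, ∃ p, IsP G W m p := by
      intro m
      induction m with
      | zero => exact h0
      | succ m ih => exact hc m ih
    obtain ⟨p, hp⟩ := this (Fintype.card V + 1)
    exact absurd (hbd _ _ hp) (by omega)
  obtain ⟨x, hx, hx1, hx2, -⟩ := third_nbr W hdeg (p 0) (hp.1 0 (by omega)) (p 1) (p 1)
  obtain ⟨y, hy, hy1, hy2, hy3⟩ := third_nbr W hdeg (p 0) (hp.1 0 (by omega)) (p 1) x
  obtain ⟨i, hi, rfl⟩ := nbr_on_path W m hmax p hp x hx hx1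
  obtain ⟨j, hj, rfl⟩ := nbr_on_path W m hmax p hp y hy hy1
  have hi0 : i ≠ 0 := by rintro rfl; exact hx1.ne rfl
  have hi1 : i ≠ 1 := by rintro rfl; exact hx2 rfl
  have hj0 : j ≠ 0 := by rintro rfl; exact hy1.ne rfl
  have hj1 : j ≠ 1 := by rintro rfl; exact hy2 rfl
  have hij : j ≠ i := by rintro rfl; exact hy3 rfl
  rcases lt_or_gt_of_ne hij with h | h
  · exact hG (k4_main W hdeg m hmax j p hp i (by omega) h hi hy1 hx1)
  · exact hG (k4_main W hdeg m hmax i p hp j (by omega) h hj hx1 hy1)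

theorem exists_D_col [Fintype V] (hG : ¬ HasMinor G (completeGraph (Fin 4))) :
    ∀ (n : ℕ) (W : Finset V), W.card = n → ∃ (D : V → V → Prop) (col : V → Fin 3),
      (∀ u v, D u v → G.Adj u v ∧ u ∈ W) ∧ (∀ u ∈ W, ∀ v ∈ W, G.Adj u v → D u v ∨ D v u) ∧
      (∀ u, (univ.filter (D u)).card ≤ 2) ∧ (∀ u ∈ W, ∀ v ∈ W, G.Adj u v → col u ≠ col v) := by
  intro n
  induction n with
  | zero =>
    intro W hW
    rw [card_eq_zero] at hW
    subst hW
    exact ⟨fun _ _ => False, fun _ => 0, by simp, by simp, by simp, by simp⟩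
  | succ n ih =>
    intro W hW
    have hne : W.Nonempty := by rw [← card_pos]; omega
    obtain ⟨v, hv, hdeg⟩ := exists_low_degree hG W hne
    obtain ⟨D, col, h1, h2, h3, h4⟩ := ih (W.erase v) (by rw [card_erase_of_mem hv]; omega)
    obtain ⟨k, hk⟩ : ∃ k : Fin 3, k ∉ (W.filter (G.Adj v)).image col := by
      by_contra hcon
      push Not at hcon
      have e1 : (univ : Finset (Fin 3)) ⊆ (W.filter (G.Adj v)).image col := fun k _ => hcon k
      have e2 := card_le_card e1
      have e3 := card_image_le (s := W.filter (G.Adj v)) (f := col)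
      simp at e2
      omega
    have hk' : ∀ w ∈ W, G.Adj v w → col w ≠ k := by
      intro w hw hvw e
      exact hk (mem_image.2 ⟨w, mem_filter.2 ⟨hw, hvw⟩, e⟩)
    refine ⟨fun u w => D u w ∨ (u = v ∧ w ∈ W ∧ G.Adj v w), fun u => if u = v then k else col u,
      ?_, ?_, ?_, ?_⟩
    · rintro u w (h | ⟨rfl, h, h'⟩)
      · exact ⟨(h1 u w h).1, mem_of_mem_erase (h1 u w h).2⟩
      · exact ⟨h', hv⟩
    · intro u hu w hw h
      by_cases huv : u = v
      · left; right; exact ⟨huv, hw, huv ▸ h⟩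
      · by_cases hwv : w = v
        · right; right; exact ⟨hwv, hu, hwv ▸ h.symm⟩
        · rcases h2 u (mem_erase.2 ⟨huv, hu⟩) w (mem_erase.2 ⟨hwv, hw⟩) h with h | h
          · exact Or.inl (Or.inl h)
          · exact Or.inr (Or.inl h)
    · intro u
      by_cases huv : u = v
      · refine le_trans (card_le_card ?_) hdeg
        intro w hw
        simp only [mem_filter, mem_univ, true_and] at hw ⊢
        rcases hw with h | h
        · exact absurd (mem_erase.1 (h1 u w h).2).1 (by simp [huv])
        · exact h.2
      · simpa [huv] using h3 u
    · intro u hu w hw h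
      by_cases huv : u = v
      · have hwv : w ≠ v := fun e => h.ne (huv.trans e.symm)
        simp only [huv, hwv, if_true, if_false]
        exact (hk' w hw (huv ▸ h)).symm
      · by_cases hwv : w = v
        · simp only [huv, hwv, if_true, if_false]
          exact hk' u hu (hwv ▸ h.symm)
        · simp only [huv, hwv, if_false]
          exact h4 u (mem_erase.2 ⟨huv, hu⟩) w (mem_erase.2 ⟨hwv, hw⟩) h

end degen

theorem stmt14 {V : Type*} [Fintype V] (G : SimpleGraph V) (hG : IsOuterplanar G) :
    ∃ o : GOrientation G, o.IsProper ∧ ∀ u, o.outDeg u ≤ 10 := by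
  classical
  obtain ⟨D, col, h0, h1, h2, h3⟩ := exists_D_col hG.1 _ univ rfl
  refine exists_orientation (D := D) (fun u v h => (h0 u v h).1)
    (fun u v h => h1 u (mem_univ _) v (mem_univ _) h) (fun u => ?_) col
    (fun u v h => h3 u (mem_univ _) v (mem_univ _) h)
  convert h2 u
end

section
/- Let r ≥ 2 and let G be a finite r-partite graph with MAD(G) ≤ 2k for an integer k. Let t be the smallest positive integer with t^{t+1} ≥ r − 1. Then χ⃗(G) ≤ k + 3r(t+1). -/
open SimpleGraph Finset

theorem frac_match {ι σ : Type*} [Fintype ι] [Fintype σ] (M : ι → σ → ℝ)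
    (h0 : ∀ i s, 0 ≤ M i s) (hr : ∀ i, ∑ s, M i s = 1) (hc : ∀ s, ∑ i, M i s ≤ 1) :
    ∃ f : ι → σ, Function.Injective f ∧ ∀ i, 0 < M i (f i) := by
  classical
  have := (Finset.all_card_le_biUnion_card_iff_exists_injective
    (fun i => univ.filter (fun s => 0 < M i s))).1 ?_
  · obtain ⟨f, hf, h⟩ := this
    exact ⟨f, hf, fun i => by simpa using h i⟩
  · intro A
    have h1 : (A.card : ℝ) = ∑ i ∈ A, ∑ s ∈ A.biUnion (fun i => univ.filter (fun s => 0 < M i s)), M i s := by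
      rw [Finset.card_eq_sum_ones]
      push_cast
      refine Finset.sum_congr rfl fun i hi => ?_
      rw [← hr i]
      symm
      apply Finset.sum_subset (Finset.subset_univ _)
      intro s _ hs
      by_contra hne
      apply hs
      simp only [Finset.mem_biUnion, Finset.mem_filter, Finset.mem_univ, true_and]
      exact ⟨i, hi, lt_of_le_of_ne (h0 i s) (Ne.symm hne)⟩
    rw [Finset.sum_comm] at h1
    have h2 : (A.card : ℝ) ≤ ∑ s ∈ A.biUnion (fun i => univ.filter (fun s => 0 < M i s)), (1:ℝ) := by
      rw [h1]
      refine Finset.sum_le_sum fun s _ => le_trans ?_ (hc s)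
      exact Finset.sum_le_sum_of_subset_of_nonneg (Finset.subset_univ _) (fun i _ _ => h0 i s)
    simp only [Finset.sum_const, nsmul_eq_mul, mul_one] at h2
    exact_mod_cast h2


theorem hakimi_aux {V : Type*} [Fintype V] [DecidableEq V] (G : SimpleGraph V) (k : ℕ)
    (h : ∀ A : Finset (Sym2 V), (↑A ⊆ G.edgeSet) →
       A.card ≤ k * (A.biUnion (fun e => univ.filter (fun v => v ∈ e))).card) :
    ∃ D : V → V → Prop, (∀ u v, D u v → G.Adj u v) ∧ (∀ u v, G.Adj u v → D u v ∨ D v u) ∧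
      ∀ u, ∀ S : Finset V, (∀ v ∈ S, D u v) → S.card ≤ k := by
  classical
  have := (Finset.all_card_le_biUnion_card_iff_exists_injective
    (fun e : G.edgeSet => univ.filter (fun s : V × Fin k => s.1 ∈ (e : Sym2 V)))).1 ?_
  · obtain ⟨f, hf, hm⟩ := this
    simp only [Finset.mem_filter, Finset.mem_univ, true_and] at hm
    refine ⟨fun u v => ∃ h : G.Adj u v, (f ⟨s(u,v), h⟩).1 = u, fun u v ⟨h, _⟩ => h, ?_, ?_⟩
    · intro u v huv
      have := hm ⟨s(u,v), huv⟩
      rcases Sym2.mem_iff.1 this with h1 | h1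
      · exact Or.inl ⟨huv, h1⟩
      · refine Or.inr ⟨huv.symm, ?_⟩
        have : (⟨s(v,u), huv.symm⟩ : G.edgeSet) = ⟨s(u,v), huv⟩ := Subtype.ext Sym2.eq_swap
        rw [this]; exact h1
    · intro u S hS
      have : ∀ v : S, ∃ h : G.Adj u v, (f ⟨s(u,v), h⟩).1 = u := fun v => hS v v.2
      choose h1 h2 using this
      have hinj : Function.Injective (fun v : S => (f ⟨s(u,v), h1 v⟩).2) := by
        intro v w hvw
        have e : f ⟨s(u,v), h1 v⟩ = f ⟨s(u,w), h1 w⟩ := Prod.ext ((h2 v).trans (h2 w).symm) hvw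
        have := congrArg Subtype.val (hf e)
        exact Subtype.ext (Sym2.congr_right.1 this)
      have := Fintype.card_le_of_injective _ hinj
      simpa using this
  · intro A
    have hA := h (A.map ⟨Subtype.val, Subtype.val_injective⟩) (by
      intro e he
      simp at he
      exact he.1)
    rw [Finset.card_map] at hA
    refine hA.trans ?_
    rw [mul_comm]
    have : k = (univ : Finset (Fin k)).card := by simp
    conv_lhs => rw [this]
    rw [← Finset.card_product]
    apply Finset.card_le_card
    intro s hs
    simp at hs ⊢
    exact hs

theorem hakimi {V : Type*} [Fintype V] (G : SimpleGraph V) (k : ℕ) (hmad : mad G ≤ 2 * (k : ℝ)) :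
    ∃ D : V → V → Prop, (∀ u v, D u v → G.Adj u v) ∧ (∀ u v, G.Adj u v → D u v ∨ D v u) ∧
      ∀ u, ∀ S : Finset V, (∀ v ∈ S, D u v) → S.card ≤ k := by
  classical
  apply hakimi_aux
  intro A hA
  rcases A.eq_empty_or_nonempty with rfl | hne
  · simp
  set W := A.biUnion (fun e => univ.filter (fun v => v ∈ e)) with hW
  have memW : ∀ v, v ∈ W ↔ ∃ e ∈ A, v ∈ e := fun v => by simp [hW]
  let H : G.Subgraph :=
    { verts := ↑W
      Adj := fun u v => s(u, v) ∈ A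
      adj_sub := fun {u v} h => hA h
      edge_vert := fun {u v} h => (memW u).2 ⟨_, h, Sym2.mem_mk_left _ _⟩
      symm := ⟨fun u v h => by rw [Sym2.eq_swap]; exact h⟩ }
  have hE : H.edgeSet = ↑A := by
    ext e
    induction e with
    | _ u v => rfl
  have hWne : W.Nonempty := by
    obtain ⟨e, he⟩ := hne
    induction e with
    | _ u v => exact ⟨u, (memW u).2 ⟨_, he, Sym2.mem_mk_left _ _⟩⟩
  have hbdd : BddAbove {x : ℝ | ∃ H : G.Subgraph, H.verts.Nonempty ∧
      x = 2 * H.edgeSet.ncard / H.verts.ncard} := by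
    apply Set.Finite.bddAbove
    apply (Set.finite_range (fun H : G.Subgraph => (2 * H.edgeSet.ncard / H.verts.ncard : ℝ))).subset
    rintro x ⟨H, _, rfl⟩
    exact ⟨H, rfl⟩
  have h1 := le_csSup hbdd ⟨H, by simpa [H] using hWne, rfl⟩
  have h2 := h1.trans hmad
  rw [hE] at h2
  have : H.verts = ↑W := rfl
  rw [this, Set.ncard_coe_finset, Set.ncard_coe_finset, div_le_iff₀ (by exact_mod_cast hWne.card_pos)] at h2
  have h3 : (A.card : ℝ) ≤ k * W.card := by linarith
  exact_mod_cast h3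
/-- A fractional orientation can be rounded. -/
theorem round_orient {V : Type*} [Fintype V] (H : SimpleGraph V) (x : V → V → ℝ)
    (h0 : ∀ u v, 0 ≤ x u v) (h1 : ∀ u v, H.Adj u v → x u v + x v u = 1)
    (h2 : ∀ u v, ¬ H.Adj u v → x u v = 0) (c : V → ℕ) (hc : ∀ u, ∑ v, x u v ≤ c u) :
    ∃ y : V → V → ℝ, (∀ u v, y u v = 0 ∨ y u v = 1) ∧
      (∀ u v, H.Adj u v → y u v + y v u = 1) ∧ (∀ u v, 0 < y u v → 0 < x u v) ∧
      (∀ u, ∑ v, y u v ≤ c u) ∧ (∀ u, ∑ v, x u v = c u → ∑ v, y u v = c u) := by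
  classical
  obtain ⟨ordV⟩ : Nonempty (LinearOrder V) := ⟨linearOrderOfSTO WellOrderingRel⟩
  set w : V → ℝ := fun u => ∑ v, x u v with hw
  let E : Finset (V × V) := univ.filter (fun q : V × V => H.Adj q.1 q.2 ∧ q.1 < q.2)
  have memE : ∀ a b, (a, b) ∈ E ↔ H.Adj a b ∧ a < b := fun a b => by simp [E]
  have w0 : ∀ u, 0 ≤ w u := fun u => Finset.sum_nonneg fun v _ => h0 u v
  have hEsum : ∀ g : V → V → ℝ, (∀ u v, ¬ H.Adj u v → g u v = 0) →
      ∑ q ∈ E, (g q.1 q.2 + g q.2 q.1) = ∑ u, ∑ v, g u v := by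
    intro g hg
    rw [Finset.sum_add_distrib, Finset.sum_filter, Finset.sum_filter]
    rw [Fintype.sum_prod_type, Fintype.sum_prod_type_right, ← Finset.sum_add_distrib]
    refine Finset.sum_congr rfl fun u _ => ?_
    rw [← Finset.sum_add_distrib]
    refine Finset.sum_congr rfl fun v _ => ?_
    by_cases ha : H.Adj u v
    · rcases lt_trichotomy u v with h | h | h
      · simp [ha, ha.symm, h, h.not_gt]
      · exact absurd h ha.ne
      · simp [ha, ha.symm, h, h.not_gt]
    · have hb : ¬ H.Adj v u := fun h => ha h.symm
      simp [ha, hb, hg u v ha]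
  have hcard : (E.card : ℝ) = ∑ u, w u := by
    rw [hw, ← hEsum x h2, Finset.card_eq_sum_ones]
    push_cast
    refine Finset.sum_congr rfl fun q hq => ?_
    rw [h1 _ _ ((memE q.1 q.2).1 hq).1]
  have hK : E.card ≤ ∑ u, c u := by
    have : (E.card : ℝ) ≤ ∑ u, (c u : ℝ) := by
      rw [hcard]; exact Finset.sum_le_sum fun u _ => hc u
    exact_mod_cast this
  obtain ⟨K, hKe⟩ := Nat.exists_eq_add_of_le hK
  have hKr : (K : ℝ) = ∑ u, (c u : ℝ) - ∑ u, w u := by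
    rw [← hcard]
    have : ((∑ u, c u : ℕ) : ℝ) = E.card + K := by rw [hKe]; push_cast; ring
    push_cast at this
    linarith
  let g : V → V → V → ℝ := fun a u v => if u = a then x a v else 0
  have g0 : ∀ a u v, 0 ≤ g a u v := fun a u v => by
    simp only [g]; split_ifs; exacts [h0 _ _, le_rfl]
  have gna : ∀ a u v, ¬ H.Adj u v → g a u v = 0 := fun a u v h => by
    simp only [g]; split_ifs with h'
    · rw [← h']; exact h2 _ _ h
    · rfl
  have gsum : ∀ a, ∑ u, ∑ v, g a u v = w a := by
    intro a
    rw [Finset.sum_eq_single a]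
    · simp [g, hw]
    · intro b _ hb; simp [g, hb]
    · simp
  have czero : ∀ a, c a = 0 → w a = 0 := fun a h => by
    have := hc a; rw [h] at this; simp at this; exact le_antisymm this (w0 a)
  have xle : ∀ a v, x a v ≤ w a := fun a v =>
    Finset.single_le_sum (f := fun v => x a v) (fun v _ => h0 a v) (mem_univ v)
  have czero' : ∀ a v, c a = 0 → x a v = 0 := fun a v h =>
    le_antisymm ((xle a v).trans (czero a h).le) (h0 a v)
  let M : (E ⊕ Fin K) → (Σ v, Fin (c v)) → ℝ := fun i s =>
    Sum.elim (fun e : E => (g s.1 e.1.1 e.1.2 + g s.1 e.1.2 e.1.1) / c s.1)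
      (fun _ => (1 - w s.1 / c s.1) / K) i
  have wc : ∀ a, w a / c a ≤ 1 := fun a => div_le_one_of_le₀ (hc a) (Nat.cast_nonneg _)
  obtain ⟨f, hf, hfM⟩ := frac_match M (by
    rintro (e | i) s
    · exact div_nonneg (add_nonneg (g0 _ _ _) (g0 _ _ _)) (Nat.cast_nonneg _)
    · exact div_nonneg (by linarith [wc s.1]) (Nat.cast_nonneg _)) (by
    rintro (e | i)
    · simp only [M, Sum.elim_inl]
      rw [Fintype.sum_sigma]
      simp only [Finset.sum_const, Finset.card_univ, Fintype.card_fin, nsmul_eq_mul]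
      have : ∀ a, (c a : ℝ) * ((g a e.1.1 e.1.2 + g a e.1.2 e.1.1) / c a)
          = g a e.1.1 e.1.2 + g a e.1.2 e.1.1 := by
        intro a
        by_cases hca : c a = 0
        · simp [g, czero' a _ hca, hca]
        · have : (c a : ℝ) ≠ 0 := Nat.cast_ne_zero.2 hca
          field_simp
      simp only [this]
      rw [Finset.sum_add_distrib]
      simp only [g, Finset.sum_ite_eq, Finset.mem_univ, if_true]
      exact h1 _ _ ((memE _ _).1 e.2).1
    · simp only [M, Sum.elim_inr]
      rw [Fintype.sum_sigma]
      simp only [Finset.sum_const, Finset.card_univ, Fintype.card_fin, nsmul_eq_mul]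
      have hK0 : (K : ℝ) ≠ 0 := Nat.cast_ne_zero.2 (Nat.pos_of_ne_zero (by
        rintro rfl; exact i.elim0)).ne'
      have : ∀ a, (c a : ℝ) * ((1 - w a / c a) / K) = (c a - w a) / K := by
        intro a
        by_cases hca : c a = 0
        · simp [hca, czero a hca]
        · have : (c a : ℝ) ≠ 0 := Nat.cast_ne_zero.2 hca
          field_simp
      simp only [this]
      rw [← Finset.sum_div, Finset.sum_sub_distrib, ← hKr, div_self hK0]) (by
    rintro ⟨a, i⟩
    rw [Fintype.sum_sum_type]
    simp only [M, Sum.elim_inl, Sum.elim_inr]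
    rw [← Finset.sum_div, Finset.sum_coe_sort E (fun e => g a e.1 e.2 + g a e.2 e.1),
      hEsum _ (gna a), gsum]
    simp only [Finset.sum_const, Finset.card_univ, Fintype.card_fin, nsmul_eq_mul]
    by_cases hK0 : (K : ℝ) = 0
    · rw [hK0]; simpa using wc a
    · rw [mul_div_cancel₀ _ hK0]; linarith)
  have hbij : Function.Bijective f := by
    rw [Fintype.bijective_iff_injective_and_card]
    refine ⟨hf, ?_⟩
    simp [hKe]
  let own : V × V → V := fun q => if h : q ∈ E then (f (Sum.inl ⟨q, h⟩)).1 else q.1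
  have ownx : ∀ q ∈ E, (own q = q.1 ∧ 0 < x q.1 q.2) ∨ (own q = q.2 ∧ 0 < x q.2 q.1) := by
    intro q hq
    have hM := hfM (Sum.inl ⟨q, hq⟩)
    simp only [M, Sum.elim_inl] at hM
    have ho : own q = (f (Sum.inl ⟨q, hq⟩)).1 := by simp only [own, hq, dif_pos]
    rw [← ho] at hM
    have hM' : 0 < g (own q) q.1 q.2 + g (own q) q.2 q.1 := by
      by_contra hcon
      have := div_nonpos_of_nonpos_of_nonneg (not_lt.1 hcon) (Nat.cast_nonneg (α := ℝ) (c (own q)))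
      linarith
    by_cases e1 : q.1 = own q
    · have hne : q.2 ≠ own q := by rw [← e1]; exact ((memE _ _).1 hq).2.ne'
      simp only [g, if_pos e1, if_neg hne, add_zero] at hM'
      rw [← e1] at hM'
      exact Or.inl ⟨e1.symm, hM'⟩
    · simp only [g, if_neg e1, zero_add] at hM'
      by_cases e2 : q.2 = own q
      · rw [if_pos e2, ← e2] at hM'
        exact Or.inr ⟨e2.symm, hM'⟩
      · rw [if_neg e2] at hM'; exact absurd hM' (lt_irrefl _)
  let y : V → V → ℝ := fun a b =>
    if ((a, b) ∈ E ∧ own (a, b) = a) ∨ ((b, a) ∈ E ∧ own (b, a) = a) then 1 else 0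
  have ypos : ∀ a b, a < b → H.Adj a b → y a b = if own (a, b) = a then 1 else 0 := by
    intro a b hab had
    have e1 : (a, b) ∈ E := (memE _ _).2 ⟨had, hab⟩
    have e2 : (b, a) ∉ E := fun h => ((memE _ _).1 h).2.not_gt hab
    simp [y, e1, e2]
  have yneg : ∀ a b, a < b → H.Adj a b → y b a = if own (a, b) = b then 1 else 0 := by
    intro a b hab had
    have e1 : (a, b) ∈ E := (memE _ _).2 ⟨had, hab⟩
    have e2 : (b, a) ∉ E := fun h => ((memE _ _).1 h).2.not_gt hab
    simp [y, e1, e2]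
  have ynon : ∀ a b, ¬ H.Adj a b → y a b = 0 := by
    intro a b hn
    have e1 : (a, b) ∉ E := fun h => hn ((memE _ _).1 h).1
    have e2 : (b, a) ∉ E := fun h => hn ((memE _ _).1 h).1.symm
    simp [y, e1, e2]
  have ysum : ∀ a, ∑ b, y a b = ∑ q ∈ E, if own q = a then (1:ℝ) else 0 := by
    intro a
    have : ∑ b, y a b = ∑ u, ∑ v, if u = a then y a v else 0 := by
      symm
      rw [Finset.sum_eq_single a]
      · simp
      · intro b _ hb; simp [hb]
      · simp
    rw [this, ← hEsum]
    · refine Finset.sum_congr rfl fun q hq => ?_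
      obtain ⟨p1, p2⟩ := (memE q.1 q.2).1 hq
      by_cases e1 : q.1 = a
      · subst e1
        simp [p2.ne', ypos _ _ p2 p1]
      · by_cases e2 : q.2 = a
        · subst e2
          simp [p2.ne, yneg _ _ p2 p1]
        · have : own q ≠ a := by
            rcases ownx q hq with h | h
            · rw [h.1]; exact e1
            · rw [h.1]; exact e2
          simp [e1, e2, this]
    · intro u v hn
      split_ifs with h
      · subst h; exact ynon _ _ hn
      · rfl
  have total : ∀ a, (∑ q ∈ E, if own q = a then (1:ℝ) else 0) +
      ∑ i : Fin K, (if (f (Sum.inr i)).1 = a then (1:ℝ) else 0) = c a := by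
    intro a
    have e1 : ∑ i, (if (f i).1 = a then (1:ℝ) else 0) = ∑ s : (Σ v, Fin (c v)), if s.1 = a then (1:ℝ) else 0 :=
      hbij.sum_comp (fun s => if s.1 = a then (1:ℝ) else 0)
    rw [Fintype.sum_sum_type, Fintype.sum_sigma] at e1
    have e2 : ∑ v, ∑ _i : Fin (c v), (if v = a then (1:ℝ) else 0) = c a := by
      simp
    rw [e2] at e1
    rw [← e1, ← Finset.sum_coe_sort E]
    congr 1
    refine Finset.sum_congr rfl fun q _ => ?_
    have : own q = (f (Sum.inl q)).1 := by
      simp only [own, q.2, dif_pos]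
    rw [this]
  have dnn : ∀ a, 0 ≤ ∑ i : Fin K, (if (f (Sum.inr i)).1 = a then (1:ℝ) else 0) := fun a =>
    Finset.sum_nonneg fun i _ => by split_ifs <;> norm_num
  refine ⟨y, ?_, ?_, ?_, ?_, ?_⟩
  · intro u v; simp only [y]; split_ifs
    · exact Or.inr rfl
    · exact Or.inl rfl
  · have key : ∀ u v, u < v → H.Adj u v → y u v + y v u = 1 := by
      intro u v huv had
      rw [ypos _ _ huv had, yneg _ _ huv had]
      rcases ownx (u, v) ((memE _ _).2 ⟨had, huv⟩) with h | h
      · simp [h.1, huv.ne]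
      · simp [h.1, huv.ne']
    intro u v had
    rcases lt_or_gt_of_ne had.ne with h | h
    · exact key u v h had
    · rw [add_comm]; exact key v u h had.symm
  · intro u v hp
    have : ((u, v) ∈ E ∧ own (u, v) = u) ∨ ((v, u) ∈ E ∧ own (v, u) = u) := by
      by_contra hn
      simp only [y, if_neg hn] at hp
      exact lt_irrefl _ hp
    rcases this with ⟨hE, ho⟩ | ⟨hE, ho⟩
    · rcases ownx _ hE with h | h
      · exact h.2
      · exact absurd (ho.symm.trans h.1) ((memE _ _).1 hE).2.ne
    · rcases ownx _ hE with h | h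
      · exact absurd (ho.symm.trans h.1) ((memE _ _).1 hE).2.ne'
      · exact h.2
  · intro u
    rw [ysum]; linarith [total u, dnn u]
  · intro u hu
    rw [ysum, ← total u]
    have : ∑ i : Fin K, (if (f (Sum.inr i)).1 = u then (1:ℝ) else 0) = 0 := by
      refine Finset.sum_eq_zero fun i _ => ?_
      rw [if_neg]
      intro h
      have hM := hfM (Sum.inr i)
      simp only [M, Sum.elim_inr] at hM
      rw [h] at hM
      have hcpos : 0 < c u := by
        have := (f (Sum.inr i)).2.pos
        rwa [h] at this
      have e : w u / c u = 1 := by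
        rw [hw]; simp only; rw [hu]; exact div_self (Nat.cast_ne_zero.2 hcpos.ne')
      rw [e] at hM
      simp at hM
    rw [this, add_zero]

section PO
set_option linter.unusedSectionVars false
open scoped Classical

variable {V : Type*} [Fintype V]

/-- fractional outdegree -/
noncomputable def wtx (x : V → V → ℝ) (u : V) : ℝ := ∑ v, x u v

/-- potential -/
noncomputable def potx (G : SimpleGraph V) (F : Set V) (x : V → V → ℝ) (u : V) : ℝ :=
  ∑ v, (x u v + if v ∉ F ∧ G.Adj u v then 1 else 0)

/-- state -/
structure St (G : SimpleGraph V) (D : V → V → Prop) (F : Set V) (x : V → V → ℝ) : Prop where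
  nn : ∀ u v, 0 ≤ x u v
  pair : ∀ u v, G.Adj u v → (u ∈ F ∨ v ∈ F) → x u v + x v u = 1
  zero : ∀ u v, ¬ (G.Adj u v ∧ (u ∈ F ∨ v ∈ F)) → x u v = 0
  supp : ∀ u v, u ∉ F → v ∈ F → 0 < x u v → D u v

/-- Basic orientation -/
structure BO (G : SimpleGraph V) (D : V → V → Prop) (k : ℕ) : Prop where
  sub : ∀ u v, D u v → G.Adj u v
  tot : ∀ u v, G.Adj u v → D u v ∨ D v u
  card : ∀ u, ∀ S : Finset V, (∀ v ∈ S, D u v) → S.card ≤ k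

theorem potx_eq (G : SimpleGraph V) (F : Set V) (x : V → V → ℝ) (u : V) :
    potx G F x u = wtx x u + ((univ.filter fun v => v ∉ F ∧ G.Adj u v).card : ℕ) := by
  unfold potx wtx
  rw [Finset.sum_add_distrib]
  simp

theorem St.start (G : SimpleGraph V) (D : V → V → Prop) : St G D ∅ (fun _ _ => 0) := by
  constructor <;> simp

theorem wtx_nat {y : V → V → ℝ} (h : ∀ u v, y u v = 0 ∨ y u v = 1) (u : V) :
    wtx y u = ((univ.filter fun v => y u v = 1).card : ℕ) := by
  unfold wtx
  rw [Finset.card_filter]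
  push_cast
  refine Finset.sum_congr rfl fun v _ => ?_
  rcases h u v with h | h <;> simp [h]

theorem potx_nat {G : SimpleGraph V} {F : Set V} {y : V → V → ℝ}
    (h : ∀ u v, y u v = 0 ∨ y u v = 1) (u : V) : ∃ n : ℕ, potx G F y u = n := by
  rw [potx_eq, wtx_nat h]
  exact ⟨_, (Nat.cast_add _ _).symm⟩

theorem St.round {G : SimpleGraph V} {D : V → V → Prop} {F : Set V} {x : V → V → ℝ}
    (hS : St G D F x) (hF : ∀ u ∈ F, ∃ n : ℕ, wtx x u = n) :
    ∃ y, St G D F y ∧ (∀ u v, y u v = 0 ∨ y u v = 1) ∧ (∀ u ∈ F, wtx y u = wtx x u) ∧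
      ∀ u, ∀ n : ℕ, potx G F x u ≤ n → potx G F y u ≤ n := by
  let H : SimpleGraph V :=
    { Adj := fun u v => G.Adj u v ∧ (u ∈ F ∨ v ∈ F)
      symm := ⟨fun u v h => ⟨h.1.symm, h.2.symm⟩⟩
      loopless := ⟨fun u h => G.irrefl h.1⟩ }
  obtain ⟨y, y01, y1, yx, yc, yt⟩ := round_orient H x hS.nn (fun u v h => hS.pair u v h.1 h.2)
    hS.zero (fun u => ⌈wtx x u⌉₊) (fun u => Nat.le_ceil _)
  refine ⟨y, ⟨?_, ?_, ?_, ?_⟩, y01, ?_, ?_⟩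
  · intro u v; rcases y01 u v with h | h <;> simp [h]
  · intro u v h h'; exact y1 u v ⟨h, h'⟩
  · intro u v h
    rcases y01 u v with h' | h'
    · exact h'
    · have := yx u v (by rw [h']; norm_num)
      rw [hS.zero u v h] at this
      exact absurd this (lt_irrefl _)
  · intro u v hu hv h
    exact hS.supp u v hu hv (yx u v h)
  · intro u hu
    obtain ⟨n, hn⟩ := hF u hu
    have : wtx x u = (⌈wtx x u⌉₊ : ℕ) := by rw [hn]; simp
    have h2 := yt u this
    rw [this]
    exact h2
  · intro u n hn
    rw [potx_eq] at hn ⊢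
    set b := (univ.filter fun v => v ∉ F ∧ G.Adj u v).card
    have h0 : 0 ≤ wtx x u := Finset.sum_nonneg fun v _ => hS.nn u v
    have hb : b ≤ n := by
      have : (b : ℝ) ≤ n := by linarith
      exact_mod_cast this
    obtain ⟨m, rfl⟩ := Nat.exists_eq_add_of_le hb
    have : ⌈wtx x u⌉₊ ≤ m := by
      rw [Nat.ceil_le]; push_cast at hn; linarith
    have h3 : wtx y u ≤ (⌈wtx x u⌉₊ : ℕ) := yc u
    have h4 : ((⌈wtx x u⌉₊ : ℕ) : ℝ) ≤ m := by exact_mod_cast this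
    push_cast
    linarith

theorem St.le_one {G : SimpleGraph V} {D : V → V → Prop} {F : Set V} {x : V → V → ℝ}
    (hS : St G D F x) (u v : V) : x u v ≤ 1 := by
  by_cases h : G.Adj u v ∧ (u ∈ F ∨ v ∈ F)
  · linarith [hS.pair u v h.1 h.2, hS.nn v u]
  · rw [hS.zero u v h]; norm_num

theorem St.incount {G : SimpleGraph V} {D : V → V → Prop} {F : Set V} {x : V → V → ℝ} {k : ℕ}
    (hD : BO G D k) (hS : St G D F x) (z : V) (hz : z ∉ F) :
    potx G F x z ≤ k + ((univ.filter fun u => u ∉ F ∧ D u z).card : ℕ) := by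
  have h1 : ((univ.filter fun v => D z v).card : ℝ) ≤ k := by
    exact_mod_cast hD.card z _ (by simp)
  have h2 : potx G F x z ≤ ((univ.filter fun v => D z v).card : ℝ) +
      ((univ.filter fun u => u ∉ F ∧ D u z).card : ℕ) := by
    rw [Finset.card_filter, Finset.card_filter]
    push_cast
    rw [← Finset.sum_add_distrib]
    refine Finset.sum_le_sum fun v _ => ?_
    by_cases hv : v ∈ F
    · by_cases hd : D z v
      · simp [hv, hd, hS.le_one z v]
      · have : ¬ 0 < x z v := fun h => hd (hS.supp z v hz hv h)
        simp [hv, hd]; linarith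
    · have h0 : x z v = 0 := hS.zero z v (by tauto)
      by_cases ha : G.Adj z v
      · rcases hD.tot z v ha with h | h
        · simp [h0, hv, ha, h]; split_ifs <;> norm_num
        · simp [h0, hv, ha, h]; split_ifs <;> norm_num
      · simp [h0, ha]; split_ifs <;> norm_num
  linarith

theorem level_step {G : SimpleGraph V} {D : V → V → Prop} {F : Set V} {x : V → V → ℝ} {k : ℕ}
    (hD : BO G D k) (hS : St G D F x) (I : Set V) (hIF : ∀ z ∈ I, z ∉ F)
    (hind : ∀ a ∈ I, ∀ b ∈ I, ¬ G.Adj a b) (Av : V → Finset V)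
    (hAv : ∀ z ∈ I, ∀ u ∈ Av z, u ∉ F ∧ D u z) (θ η : ℝ) (hη0 : 0 ≤ η) (hη : η ≤ 1)
    (hθ : ∀ z ∈ I, θ ≤ potx G F x z)
    (hload : ∀ z ∈ I, potx G F x z - θ ≤ η * (Av z).card) :
    ∃ x', St G D (F ∪ I) x' ∧ (∀ u ∈ F, wtx x' u = wtx x u) ∧ (∀ z ∈ I, wtx x' z = θ) ∧
      ∀ u, u ∉ F → u ∉ I → potx G (F ∪ I) x' u ≤ potx G F x u -
        ∑ z, if z ∈ I ∧ G.Adj u z then 1 - (if u ∈ Av z then η else 0) else 0 := by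
  let γ : V → V → ℝ := fun z u => if u ∈ Av z then (potx G F x z - θ) / (Av z).card else 0
  have γ0 : ∀ z ∈ I, ∀ u, 0 ≤ γ z u := by
    intro z hz u; simp only [γ]; split_ifs
    · exact div_nonneg (by linarith [hθ z hz]) (Nat.cast_nonneg _)
    · exact le_rfl
  have γη : ∀ z ∈ I, ∀ u, γ z u ≤ if u ∈ Av z then η else 0 := by
    intro z hz u; simp only [γ]; split_ifs with h
    · rw [div_le_iff₀ (by exact_mod_cast Finset.card_pos.2 ⟨u, h⟩)]
      exact hload z hz
    · exact le_rfl
  have γ1 : ∀ z ∈ I, ∀ u, γ z u ≤ 1 := by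
    intro z hz u; have := γη z hz u; split_ifs at this <;> linarith
  have γD : ∀ z ∈ I, ∀ u, γ z u ≠ 0 → u ∉ F ∧ D u z := by
    intro z hz u h
    apply hAv z hz
    by_contra hn
    exact h (by simp [γ, hn])
  let x' : V → V → ℝ := fun a b =>
    if a ∈ I ∧ b ∉ F ∧ G.Adj a b then 1 - γ a b
    else if b ∈ I ∧ a ∉ F ∧ G.Adj a b then γ b a else x a b
  have x1 : ∀ a b, a ∈ I → b ∉ F → G.Adj a b → x' a b = 1 - γ a b := fun a b h1 h2 h3 => by
    simp [x', h1, h2, h3]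
  have x2 : ∀ a b, b ∈ I → a ∉ F → G.Adj a b → x' a b = γ b a := fun a b h1 h2 h3 => by
    have : a ∉ I := fun h => hind a h b h1 h3
    simp [x', h1, h2, h3, this]
  have x3 : ∀ a b, ¬ (a ∈ I ∧ b ∉ F ∧ G.Adj a b) → ¬ (b ∈ I ∧ a ∉ F ∧ G.Adj a b) →
      x' a b = x a b := fun a b h1 h2 => by
    simp only [x', if_neg h1, if_neg h2]
  refine ⟨x', ⟨?_, ?_, ?_, ?_⟩, ?_, ?_, ?_⟩
  · intro u v
    simp only [x']
    split_ifs with h1 h2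
    · linarith [γ1 u h1.1 v]
    · exact γ0 v h2.1 u
    · exact hS.nn u v
  · intro u v ha hm
    by_cases c1 : u ∈ I ∧ v ∉ F
    · rw [x1 u v c1.1 c1.2 ha, x2 v u c1.1 c1.2 ha.symm]; ring
    · by_cases c2 : v ∈ I ∧ u ∉ F
      · rw [x1 v u c2.1 c2.2 ha.symm, x2 u v c2.1 c2.2 ha]; ring
      · rw [x3 u v (by tauto) (by tauto), x3 v u (by tauto) (by tauto)]
        apply hS.pair u v ha
        rcases hm with (h | h) | (h | h) <;> tauto
  · intro u v h
    have : ¬ (G.Adj u v ∧ (u ∈ F ∨ v ∈ F)) := fun h' => h ⟨h'.1, h'.2.imp Or.inl Or.inl⟩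
    rw [x3 u v, hS.zero u v this]
    · rintro ⟨a, b, c⟩; exact h ⟨c, Or.inl (Or.inr a)⟩
    · rintro ⟨a, b, c⟩; exact h ⟨c, Or.inr (Or.inr a)⟩
  · intro u v hu hv hpos
    have hu1 : u ∉ F := fun h => hu (Or.inl h)
    have hu2 : u ∉ I := fun h => hu (Or.inr h)
    by_cases c2 : v ∈ I ∧ u ∉ F ∧ G.Adj u v
    · rw [x2 u v c2.1 c2.2.1 c2.2.2] at hpos
      exact (γD v c2.1 u hpos.ne').2
    · rw [x3 u v (by tauto) c2] at hpos
      by_cases hvF : v ∈ F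
      · exact hS.supp u v hu1 hvF hpos
      · rw [hS.zero u v (by tauto)] at hpos
        exact absurd hpos (lt_irrefl _)
  · intro u hu
    refine Finset.sum_congr rfl fun v _ => x3 u v ?_ ?_
    · exact fun h => hIF u h.1 hu
    · exact fun h => h.2.1 hu
  · intro z hz
    have e : wtx x' z = ∑ v, ((x z v + if v ∉ F ∧ G.Adj z v then 1 else 0) - γ z v) := by
      refine Finset.sum_congr rfl fun v _ => ?_
      by_cases c : v ∉ F ∧ G.Adj z v
      · rw [x1 z v hz c.1 c.2, hS.zero z v (by have := hIF z hz; tauto), if_pos c]; ring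
      · have h0 : γ z v = 0 := by
          by_contra h
          have := γD z hz v h
          exact c ⟨this.1, (hD.sub _ _ this.2).symm⟩
        have := hind z hz v
        rw [x3 z v (by tauto) (by tauto), if_neg c, h0]; ring
    rw [e, Finset.sum_sub_distrib]
    have e2 : ∑ v, γ z v = potx G F x z - θ := by
      simp only [γ]
      rw [Finset.sum_ite_mem, Finset.univ_inter, Finset.sum_const, nsmul_eq_mul]
      by_cases hc : ((Av z).card : ℝ) = 0
      · have := hload z hz
        rw [hc] at this ⊢
        linarith [hθ z hz]
      · field_simp
    rw [e2]
    change potx G F x z - _ = _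
    ring
  · intro u hu hu'
    unfold potx
    rw [← Finset.sum_sub_distrib]
    refine Finset.sum_le_sum fun v _ => ?_
    by_cases c : v ∈ I ∧ G.Adj u v
    · have hvF := hIF v c.1
      rw [x2 u v c.1 hu c.2, if_pos c, if_neg (fun h => h.1 (Or.inr c.1)), if_pos ⟨hvF, c.2⟩]
      linarith [hS.nn u v, γη v c.1 u]
    · rw [if_neg c, x3 u v (by tauto) (by tauto)]
      have : (v ∉ F ∪ I ∧ G.Adj u v) ↔ (v ∉ F ∧ G.Adj u v) := by
        constructor
        · rintro ⟨h1, h2⟩; exact ⟨fun h => h1 (Or.inl h), h2⟩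
        · rintro ⟨h1, h2⟩; exact ⟨fun h => h.elim h1 (fun h => c ⟨h, h2⟩), h2⟩
      simp only [this, sub_zero, le_refl]

end PO

section PO
set_option linter.unusedSectionVars false
open scoped Classical

variable {V : Type*} [Fintype V]

/-- Finished vertices have proper natural values in `[L, m]`. -/
structure Prp (G : SimpleGraph V) (F : Set V) (x : V → V → ℝ) (L m : ℕ) : Prop where
  val : ∀ u ∈ F, ∃ n : ℕ, wtx x u = n ∧ L ≤ n ∧ n ≤ m
  ne : ∀ u ∈ F, ∀ v ∈ F, G.Adj u v → wtx x u ≠ wtx x v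

theorem Prp.congr {G : SimpleGraph V} {F : Set V} {x y : V → V → ℝ} {L m : ℕ}
    (h : Prp G F x L m) (he : ∀ u ∈ F, wtx y u = wtx x u) : Prp G F y L m := by
  refine ⟨fun u hu => ?_, fun u hu v hv => ?_⟩
  · rw [he u hu]; exact h.val u hu
  · rw [he u hu, he v hv]; exact h.ne u hu v hv

theorem Prp.step {G : SimpleGraph V} {F I : Set V} {x y : V → V → ℝ} {θ m : ℕ}
    (h : Prp G F x (θ + 1) m) (hm : θ ≤ m) (he : ∀ u ∈ F, wtx y u = wtx x u)
    (hI : ∀ u ∈ I, wtx y u = θ) (hind : ∀ a ∈ I, ∀ b ∈ I, ¬ G.Adj a b) :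
    Prp G (F ∪ I) y θ m := by
  have h' := h.congr he
  have key : ∀ u ∈ F, wtx y u ≠ θ := by
    intro u hu e
    obtain ⟨n, hn, h1, h2⟩ := h'.val u hu
    rw [e] at hn
    have : θ = n := by exact_mod_cast hn
    omega
  refine ⟨?_, ?_⟩
  · rintro u (hu | hu)
    · obtain ⟨n, hn, h1, h2⟩ := h'.val u hu
      exact ⟨n, hn, by omega, h2⟩
    · exact ⟨θ, hI u hu, le_rfl, hm⟩
  · rintro u (hu | hu) v (hv | hv) ha
    · exact h'.ne u hu v hv ha
    · rw [hI v hv]; exact key u hu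
    · rw [hI u hu]; exact (key v hv).symm
    · exact absurd ha (hind u hu v hv)

theorem level1 {G : SimpleGraph V} {D : V → V → Prop} {F : Set V} {x : V → V → ℝ} {k : ℕ}
    (hD : BO G D k) (col : V → ℕ) (hcol : ∀ u v, G.Adj u v → col u ≠ col v)
    (hS : St G D F x) (θ m : ℕ) (hm : θ ≤ m) (hP : Prp G F x (θ + 1) m)
    (d : ℕ) (η : ℝ) (hη0 : 0 ≤ η) (hη1 : η ≤ 1)
    (hT : ∀ u, u ∉ F → (θ : ℝ) ≤ potx G F x u → potx G F x u - θ ≤ η * (potx G F x u - k)) :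
    ∃ F' x', St G D F' x' ∧ Prp G F' x' θ m ∧
      ∀ u, u ∉ F' → u ∉ F ∧ (potx G F' x' u < θ ∨
        (col u ≠ d ∧ potx G F' x' u ≤ potx G F x u - 1 + η)) := by
  let T : Set V := {u | u ∉ F ∧ (θ : ℝ) ≤ potx G F x u}
  let C : Set (Set V) := {S | S ⊆ T ∧ ∀ a ∈ S, ∀ b ∈ S, ¬ G.Adj a b}
  have hC0 : {u | u ∈ T ∧ col u = d} ∈ C := by
    refine ⟨fun u hu => hu.1, fun a ha b hb hab => hcol a b hab (ha.2.trans hb.2.symm)⟩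
  obtain ⟨I, hI0, hImax⟩ := Set.Finite.exists_le_maximal (Set.toFinite C) hC0
  obtain ⟨hIT, hind⟩ := hImax.prop
  have hdom : ∀ u ∈ T, u ∉ I → ∃ z ∈ I, G.Adj u z := by
    intro u hu hn
    by_contra hcon
    push Not at hcon
    have : insert u I ∈ C := by
      refine ⟨?_, ?_⟩
      · intro v hv
        rcases hv with rfl | hv
        · exact hu
        · exact hIT hv
      · rintro a (rfl | ha) b (rfl | hb)
        · exact G.irrefl
        · exact hcon b hb
        · exact fun h => hcon a ha h.symm
        · exact hind a ha b hb
    exact hn (hImax.le_of_ge this (Set.subset_insert u I) (Set.mem_insert u I))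
  obtain ⟨x', hS', hw1, hw2, hp⟩ := level_step hD hS I (fun z hz => (hIT hz).1) hind
    (fun z => univ.filter fun u => u ∉ F ∧ D u z) (fun z _ u hu => by simpa using hu)
    θ η hη0 hη1 (fun z hz => (hIT hz).2) (fun z hz => by
      refine (hT z (hIT hz).1 (hIT hz).2).trans ?_
      apply mul_le_mul_of_nonneg_left _ hη0
      have := hS.incount hD z (hIT hz).1
      linarith)
  refine ⟨F ∪ I, x', hS', hP.step hm hw1 hw2 hind, ?_⟩
  intro u hu
  have hu1 : u ∉ F := fun h => hu (Or.inl h)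
  have hu2 : u ∉ I := fun h => hu (Or.inr h)
  have hpu := hp u hu1 hu2
  set f : V → ℝ := fun z => if z ∈ I ∧ G.Adj u z then
      1 - (if u ∈ (univ.filter fun u => u ∉ F ∧ D u z) then η else 0) else 0 with hf
  have fnn : ∀ z, 0 ≤ f z := by
    intro z; simp only [hf]; split_ifs <;> linarith
  refine ⟨hu1, ?_⟩
  by_cases hT' : (θ : ℝ) ≤ potx G F x u
  · right
    refine ⟨fun h => hu2 (hI0 ⟨⟨hu1, hT'⟩, h⟩), ?_⟩
    obtain ⟨z, hz, hza⟩ := hdom u ⟨hu1, hT'⟩ hu2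
    have h1 : f z ≤ ∑ z, f z := Finset.single_le_sum (fun z _ => fnn z) (mem_univ z)
    have h2 : 1 - η ≤ f z := by
      simp only [hf, if_pos (And.intro hz hza)]; split_ifs <;> linarith
    linarith
  · left
    have : 0 ≤ ∑ z, f z := Finset.sum_nonneg fun z _ => fnn z
    linarith

theorem cycle1 {G : SimpleGraph V} {D : V → V → Prop} {F : Set V} {x : V → V → ℝ} {k : ℕ}
    (hD : BO G D k) (col : V → ℕ) (hcol : ∀ u v, G.Adj u v → col u ≠ col v)
    (r : ℕ) (hr : ∀ u, col u < r)
    (hS : St G D F x) (a m : ℕ) (ham : a + r ≤ m) (hka : k ≤ a) (hP : Prp G F x (a + r + 1) m)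
    (X η : ℝ) (hX : 1 ≤ X) (hpot : ∀ u, u ∉ F → potx G F x u < a + r + X)
    (hη0 : 0 ≤ η) (hη1 : η ≤ 1) (hη : η = 1 ∨ X + r * η ≤ η * (a - k)) :
    ∃ F' x', St G D F' x' ∧ Prp G F' x' (a + 1) m ∧
      ∀ u, u ∉ F' → potx G F' x' u < a + 1 + (r - 1) * η := by
  have main : ∀ i j : ℕ, i + j = r → ∃ F' x', St G D F' x' ∧ Prp G F' x' (a + j + 1) m ∧
      ∀ u, u ∉ F' → (col u < i → potx G F' x' u < a + j + 1 + (i - 1) * η) ∧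
        potx G F' x' u < a + j + X + i * η := by
    intro i
    induction i with
    | zero =>
      intro j hj
      obtain rfl : j = r := by omega
      refine ⟨F, x, hS, hP, fun u hu => ⟨fun h => absurd h (Nat.not_lt_zero _), ?_⟩⟩
      have := hpot u hu
      push_cast
      linarith
    | succ i ih =>
      intro j hj
      obtain ⟨F1, x1, hS1, hP1, hb⟩ := ih (j + 1) (by omega)
      have hka' : (k : ℝ) ≤ a := by exact_mod_cast hka
      have hir : (i : ℝ) ≤ r := by exact_mod_cast (by omega : i ≤ r)
      have hjj : (0 : ℝ) ≤ j := Nat.cast_nonneg j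
      obtain ⟨F2, x2, hS2, hP2, hc⟩ := level1 hD col hcol hS1 (a + j + 1) m (by omega) hP1 i η hη0 hη1 (by
        intro u hu hθ
        have h2 := (hb u hu).2
        push_cast at hθ h2 ⊢
        rcases hη with rfl | hη
        · linarith
        · have e1 : (i : ℝ) * η ≤ r * η := mul_le_mul_of_nonneg_right hir hη0
          have e2 : η * (a - k) ≤ η * (potx G F1 x1 u - k) :=
            mul_le_mul_of_nonneg_left (by linarith) hη0
          linarith)
      refine ⟨F2, x2, hS2, hP2, ?_⟩
      intro u hu
      obtain ⟨hu1, h⟩ := hc u hu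
      obtain ⟨b1, b2⟩ := hb u hu1
      have iη : 0 ≤ (i : ℝ) * η := mul_nonneg (Nat.cast_nonneg _) hη0
      push_cast at *
      rcases h with h | ⟨h1, h2⟩
      · constructor
        · intro _; linarith
        · linarith
      · constructor
        · intro h3
          have := b1 (by omega)
          linarith
        · linarith
  obtain ⟨F', x', h1, h2, h3⟩ := main r 0 (by omega)
  refine ⟨F', x', h1, h2, fun u hu => ?_⟩
  have := (h3 u hu).1 (hr u)
  push_cast at this
  linarith

/-- the first cycle -/
theorem cycle0 {G : SimpleGraph V} {D : V → V → Prop} {k : ℕ}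
    (hD : BO G D k) (col : V → ℕ) (hcol : ∀ u v, G.Adj u v → col u ≠ col v)
    (r : ℕ) (hr : ∀ u, col u < r) (a : ℕ) (hka : k ≤ a) :
    ∃ F' x', St G D F' x' ∧ Prp G F' x' (a + 1) (a + r) ∧
      ∀ u, u ∉ F' → potx G F' x' u < a + r := by
  obtain ⟨F', x', h1, h2, h3⟩ := cycle1 hD col hcol r hr (St.start G D) a (a + r) le_rfl hka
    ⟨by simp, by simp⟩ (Fintype.card V + 1) 1 (by linarith [Nat.cast_nonneg (α := ℝ) (Fintype.card V)]) (by
      intro u _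
      have : potx G ∅ (fun _ _ => 0) u ≤ Fintype.card V := by
        unfold potx
        calc _ ≤ ∑ v : V, (1:ℝ) := Finset.sum_le_sum fun v _ => by split_ifs <;> norm_num
          _ = _ := by simp
      have : (0:ℝ) ≤ a + r := by positivity
      linarith) zero_le_one le_rfl (Or.inl rfl)
  refine ⟨F', x', h1, h2, fun u hu => ?_⟩
  have := h3 u hu
  linarith

theorem numeric1 (r t : ℕ) (ht : 2 ≤ t) (hr : r ≤ t ^ (t + 1) + 1) :
    (r : ℝ) / (2 * t + 1) ^ t + 1 + 1 / (2 * t) ≤ 2 := by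
  have h1 : 2 * t ≤ 2 ^ t := by
    clear hr
    induction t, ht using Nat.le_induction with
    | base => norm_num
    | succ n hn ih => rw [pow_succ]; omega
  have h2 : 2 ^ t * t ^ t ≤ (2 * t + 1) ^ t := by
    rw [← mul_pow]; exact Nat.pow_le_pow_left (by omega) t
  have h3 : 2 * t * r ≤ (2 * t - 1) * (2 * t + 1) ^ t := by
    obtain ⟨s, rfl⟩ : ∃ s, t = s + 1 := ⟨t - 1, by omega⟩
    have e : 2 * (s + 1) - 1 = 2 * s + 1 := by omega
    rw [e]
    have p1 : 1 ≤ (s + 1) ^ (s + 1) := Nat.one_le_pow _ _ (by omega)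
    set P := (s + 1) ^ (s + 1) with hP
    have hr' : r ≤ P * (s + 1) + 1 := by rw [hP, ← pow_succ]; exact hr
    have h4 : 2 * (s + 1) * P ≤ (2 * (s + 1) + 1) ^ (s + 1) :=
      (Nat.mul_le_mul_right _ h1).trans h2
    calc 2 * (s + 1) * r ≤ 2 * (s + 1) * (P * (s + 1) + 1) := Nat.mul_le_mul_left _ hr'
      _ ≤ 2 * (s + 1) * ((2 * s + 1) * P) := by
          apply Nat.mul_le_mul_left
          have : 1 * 1 ≤ s * P := Nat.mul_le_mul (by omega) p1
          nlinarith
      _ = (2 * s + 1) * (2 * (s + 1) * P) := by ring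
      _ ≤ _ := Nat.mul_le_mul_left _ h4
  have h3' : (2 * t * r : ℝ) ≤ (2 * t - 1) * (2 * t + 1) ^ t := by
    have e : ((2 * t - 1 : ℕ) : ℝ) = 2 * t - 1 := by
      rw [Nat.cast_sub (by omega)]; push_cast; ring
    rw [← e]
    exact_mod_cast h3
  have tp : (0 : ℝ) < t := by exact_mod_cast (by omega : 0 < t)
  have : (r : ℝ) / (2 * t + 1) ^ t ≤ (2 * t - 1) / (2 * t) := by
    rw [div_le_div_iff₀ (by positivity) (by positivity)]
    linarith
  have e : ((2 * t - 1) / (2 * t) : ℝ) = 1 - 1 / (2 * t) := by field_simp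
  linarith

theorem phase1 {G : SimpleGraph V} {D : V → V → Prop} {k : ℕ}
    (hD : BO G D k) (col : V → ℕ) (hcol : ∀ u v, G.Adj u v → col u ≠ col v)
    (r t : ℕ) (hr : ∀ u, col u < r) (hr3 : 3 ≤ r) (ht : 2 ≤ t) (hrt : r ≤ t ^ (t + 1) + 1) :
    ∃ F' x', St G D F' x' ∧ Prp G F' x' (k + r * (2 * t + 2) + 1) (k + 3 * r * (t + 1)) ∧
      ∀ u, u ∉ F' → potx G F' x' u < (k + r * (2 * t + 2) : ℕ) + 2 := by
  have tp : (2 : ℝ) ≤ t := by exact_mod_cast ht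
  have rp : (3 : ℝ) ≤ r := by exact_mod_cast hr3
  set q : ℝ := 2 * t + 1 with hq
  have main : ∀ j i : ℕ, i + j = t → ∃ F' x', St G D F' x' ∧
      Prp G F' x' (k + r * (2 * t + 2 + i) + 1) (k + 3 * r * (t + 1)) ∧
      ∀ u, u ∉ F' → potx G F' x' u < (k + r * (2 * t + 2 + i) : ℕ) + (r / q ^ j + 1 + 1 / (2 * t)) := by
    intro j
    induction j with
    | zero =>
      intro i hi
      obtain rfl : i = t := by omega
      obtain ⟨F, x, h1, h2, h3⟩ := cycle0 hD col hcol r hr (k + r * (2 * i + 2 + i)) (by omega)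
      refine ⟨F, x, h1, ?_, ?_⟩
      · have : k + r * (2 * i + 2 + i) + r = k + 3 * r * (i + 1) := by ring
        rwa [this] at h2
      · intro u hu
        have := h3 u hu
        have : (0:ℝ) < 1 / (2 * i) := by positivity
        simp only [pow_zero, div_one]
        linarith
    | succ j ih =>
      intro i hi
      obtain ⟨F, x, h1, h2, h3⟩ := ih (i + 1) (by omega)
      set X : ℝ := r / q ^ j + 1 + 1 / (2 * t) with hXd
      have hqj : (1:ℝ) ≤ q ^ j := one_le_pow₀ (by linarith)
      have hX1 : 1 ≤ X := by
        have : (0:ℝ) ≤ r / q ^ j := by positivity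
        have : (0:ℝ) ≤ 1 / (2 * t) := by positivity
        linarith
      have hXr : X ≤ r + 2 := by
        have a1 : (r:ℝ) / q ^ j ≤ r := div_le_self (by linarith) hqj
        have a2 : (1:ℝ) / (2 * t) ≤ 1 := by
          rw [div_le_one (by linarith)]; linarith
        linarith
      have hrq : (0:ℝ) < r * q := by positivity
      have hη0 : 0 ≤ X / (r * q) := by positivity
      obtain ⟨F', x', g1, g2, g3⟩ := cycle1 hD col hcol r hr h1 (k + r * (2 * t + 2 + i))
        (k + 3 * r * (t + 1)) (by
          have : k + r * (2 * t + 2 + i) + r = k + r * (2 * t + 2 + (i + 1)) := by ring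
          rw [this]
          have e : 3 * r * (t + 1) = r * (3 * t + 3) := by ring
          rw [e]
          exact Nat.add_le_add_left (Nat.mul_le_mul_left r (by omega)) k) (by omega) (by
          have : k + r * (2 * t + 2 + i) + r = k + r * (2 * t + 2 + (i + 1)) := by ring
          rwa [this]) X (X / (r * q)) hX1 (by
          intro u hu
          have := h3 u hu
          push_cast at this ⊢
          linarith) hη0 (by
          rw [div_le_one hrq]
          nlinarith) (Or.inr (by
          have e1 : X + r * (X / (r * q)) = X / (r * q) * (r * (2 * t + 2)) := by
            have h2t : (2 * t + 2 : ℝ) = q + 1 := by rw [hq]; ring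
            rw [h2t]
            have hq0 : q ≠ 0 := by positivity
            field_simp
          rw [e1]
          apply mul_le_mul_of_nonneg_left _ hη0
          push_cast
          have : (0:ℝ) ≤ r * i := by positivity
          linarith))
      refine ⟨F', x', g1, g2, fun u hu => ?_⟩
      have g := g3 u hu
      have e2 : (r - 1) * (X / (r * q)) ≤ X / q := by
        have : X / q = r * (X / (r * q)) := by field_simp
        rw [this]
        apply mul_le_mul_of_nonneg_right _ hη0
        linarith
      have e3 : 1 + X / q = r / q ^ (j + 1) + 1 + 1 / (2 * t) := by
        rw [hXd, pow_succ]
        have hq0 : q ≠ 0 := by positivity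
        field_simp
        rw [hq]; ring
      linarith
  obtain ⟨F', x', h1, h2, h3⟩ := main t 0 (by omega)
  refine ⟨F', x', h1, h2, fun u hu => ?_⟩
  have := h3 u hu
  have h4 := numeric1 r t ht hrt
  rw [← hq] at h4
  simp only [add_zero] at this
  linarith

end PO

section PO
set_option linter.unusedSectionVars false
open scoped Classical

variable {V : Type*} [Fintype V]

theorem potx_nonneg {G : SimpleGraph V} {D : V → V → Prop} {F : Set V} {x : V → V → ℝ}
    (hS : St G D F x) (u : V) : 0 ≤ potx G F x u := by
  refine Finset.sum_nonneg fun v _ => add_nonneg (hS.nn u v) ?_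
  split_ifs <;> norm_num

/-- max-weight independent sets -/
theorem wt_indep (G : SimpleGraph V) (col : V → ℕ) (hcol : ∀ u v, G.Adj u v → col u ≠ col v)
    (r : ℕ) (hr : ∀ u, col u < r) (T : Finset V) (d : ℕ) :
    ∃ I : Finset V, I ⊆ T ∧ (∀ a ∈ I, ∀ b ∈ I, ¬ G.Adj a b) ∧
      (∀ u ∈ T, u ∉ I → 1 ≤ (I.filter (G.Adj u)).card ∧
        (col u = d → 3 ≤ (I.filter (G.Adj u)).card)) ∧
      ∀ z ∈ I, ((T \ I).filter fun u => I.filter (G.Adj u) = {z}).card ≤ 3 * (r - 1) := by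
  let ω : V → ℕ := fun u => if col u = d then 3 else 1
  have ω1 : ∀ u, 1 ≤ ω u := fun u => by simp only [ω]; split_ifs <;> norm_num
  have ω3 : ∀ u, ω u ≤ 3 := fun u => by simp only [ω]; split_ifs <;> norm_num
  obtain ⟨I, hI, hmax⟩ := Finset.exists_max_image
    (T.powerset.filter fun S => ∀ a ∈ S, ∀ b ∈ S, ¬ G.Adj a b) (fun S => ∑ u ∈ S, ω u)
    ⟨∅, by simp⟩
  simp only [Finset.mem_filter, Finset.mem_powerset] at hI hmax
  obtain ⟨hIT, hind⟩ := hI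
  have exch : ∀ B N : Finset V, B ⊆ T → (∀ a ∈ B, ∀ b ∈ B, ¬ G.Adj a b) → Disjoint B I → N ⊆ I →
      (∀ b ∈ B, ∀ z ∈ I, G.Adj b z → z ∈ N) → ∑ u ∈ B, ω u ≤ ∑ u ∈ N, ω u := by
    intro B N hB hBi hBI hN hBN
    have h1 := hmax ((I \ N) ∪ B) ⟨Finset.union_subset (Finset.sdiff_subset.trans hIT) hB, by
      intro a ha b hb hab
      rw [Finset.mem_union, Finset.mem_sdiff] at ha hb
      rcases ha with ha | ha <;> rcases hb with hb | hb
      · exact hind a ha.1 b hb.1 hab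
      · exact ha.2 (hBN b hb a ha.1 hab.symm)
      · exact hb.2 (hBN a ha b hb.1 hab)
      · exact hBi a ha b hb hab⟩
    rw [Finset.sum_union (Finset.disjoint_of_subset_left Finset.sdiff_subset hBI.symm)] at h1
    have h2 := Finset.sum_sdiff hN (f := ω)
    omega
  refine ⟨I, hIT, hind, ?_, ?_⟩
  · intro u hu hn
    have h1 := exch {u} (I.filter (G.Adj u)) (by simpa using hu) (by simp) (by simpa using hn)
      (Finset.filter_subset _ _) (by
        intro b hb z hz hbz
        rw [Finset.mem_singleton] at hb
        subst hb
        exact Finset.mem_filter.2 ⟨hz, hbz⟩)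
    rw [Finset.sum_singleton] at h1
    constructor
    · by_contra hcon
      have : (I.filter (G.Adj u)) = ∅ := Finset.card_eq_zero.1 (by omega)
      rw [this] at h1
      have := ω1 u
      simp at h1
      omega
    · intro hd
      have : ∑ v ∈ I.filter (G.Adj u), ω v = ∑ v ∈ I.filter (G.Adj u), 1 := by
        refine Finset.sum_congr rfl fun v hv => ?_
        have := hcol u v (Finset.mem_filter.1 hv).2
        simp only [ω]
        rw [if_neg (fun h => this (hd.trans h.symm))]
      rw [this] at h1
      simp only [ω, hd, if_true] at h1
      simpa using h1
  · intro z hz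
    set P := (T \ I).filter fun u => I.filter (G.Adj u) = {z} with hP
    have hPz : ∀ u ∈ P, G.Adj u z := by
      intro u hu
      have := (Finset.mem_filter.1 hu).2
      have h2 : z ∈ I.filter (G.Adj u) := by rw [this]; simp
      exact (Finset.mem_filter.1 h2).2
    have h1 := Finset.card_le_mul_card_image_of_maps_to (s := P) (f := col)
      (t := (Finset.range r).erase (col z)) (by
        intro u hu
        simp only [Finset.mem_erase, Finset.mem_range]
        exact ⟨hcol u z (hPz u hu), hr u⟩) 3 (by
        intro c _
        have h2 := exch (P.filter fun u => col u = c) {z} (by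
          intro u hu
          exact (Finset.mem_sdiff.1 (Finset.mem_filter.1 (Finset.mem_filter.1 hu).1).1).1) (by
          intro a ha b hb hab
          exact hcol a b hab ((Finset.mem_filter.1 ha).2.trans (Finset.mem_filter.1 hb).2.symm)) (by
          rw [Finset.disjoint_left]
          intro u hu
          exact (Finset.mem_sdiff.1 (Finset.mem_filter.1 (Finset.mem_filter.1 hu).1).1).2)
          (by simpa using hz) (by
          intro b hb z' hz' hbz
          rw [← (Finset.mem_filter.1 (Finset.mem_filter.1 hb).1).2]
          exact Finset.mem_filter.2 ⟨hz', hbz⟩)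
        rw [Finset.sum_singleton] at h2
        have h3 : (P.filter fun u => col u = c).card ≤ ∑ u ∈ P.filter (fun u => col u = c), ω u := by
          rw [Finset.card_eq_sum_ones]
          exact Finset.sum_le_sum fun u _ => ω1 u
        exact h3.trans (h2.trans (ω3 z)))
    rw [Finset.card_erase_of_mem (Finset.mem_range.2 (hr z)), Finset.card_range] at h1
    exact h1

theorem level2 {G : SimpleGraph V} {D : V → V → Prop} {F : Set V} {x : V → V → ℝ} {k : ℕ}
    (hD : BO G D k) (col : V → ℕ) (hcol : ∀ u v, G.Adj u v → col u ≠ col v)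
    (r : ℕ) (hr : ∀ u, col u < r) (hr1 : 1 ≤ r)
    (hS : St G D F x) (h01 : ∀ u v, x u v = 0 ∨ x u v = 1)
    (θ m : ℕ) (hm : θ ≤ m) (hP : Prp G F x (θ + 1) m) (e : ℕ) (hθ : k + 3 * r + 3 * e ≤ θ + 3)
    (hpot : ∀ u, u ∉ F → potx G F x u ≤ θ + e) (d : ℕ) :
    ∃ F' x', St G D F' x' ∧ (∀ u v, x' u v = 0 ∨ x' u v = 1) ∧ Prp G F' x' θ m ∧
      ∀ u, u ∉ F' → u ∉ F ∧ (potx G F' x' u + 1 ≤ θ ∨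
        (potx G F' x' u + 1 ≤ potx G F x u ∧
          (col u = d → potx G F' x' u + 2 ≤ potx G F x u))) := by
  let T : Finset V := univ.filter fun u => u ∉ F ∧ (θ : ℝ) ≤ potx G F x u
  have memT : ∀ u, u ∈ T ↔ u ∉ F ∧ (θ : ℝ) ≤ potx G F x u := fun u => by simp [T]
  obtain ⟨I, hIT, hind, hdom, hpriv⟩ := wt_indep G col hcol r hr T d
  let P : V → Finset V := fun z => (T \ I).filter fun u => I.filter (G.Adj u) = {z}
  let Av : V → Finset V := fun z => (univ.filter fun u => u ∉ F ∧ D u z) \ P z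
  obtain ⟨x', hS', hw1, hw2, hp⟩ := level_step hD hS (I : Set V)
    (fun z hz => ((memT z).1 (hIT hz)).1) hind Av
    (fun z _ u hu => by
      have := (Finset.mem_sdiff.1 hu).1
      simpa using this) θ (1/3) (by norm_num) (by norm_num)
    (fun z hz => ((memT z).1 (hIT hz)).2) (fun z hz => by
      obtain ⟨hzF, hzθ⟩ := (memT z).1 (hIT hz)
      have h1 := hS.incount hD z hzF
      have h2 : (univ.filter fun u => u ∉ F ∧ D u z).card ≤ (Av z).card + (P z).card :=
        Finset.card_le_card_sdiff_add_card
      have h3 := hpriv z hz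
      have h4 := hpot z hzF
      have h5 : θ ≤ k + (univ.filter fun u => u ∉ F ∧ D u z).card := by
        have : (θ : ℝ) ≤ k + ((univ.filter fun u => u ∉ F ∧ D u z).card : ℕ) := hzθ.trans h1
        exact_mod_cast this
      have h6 : 3 * e ≤ (Av z).card := by
        change (P z).card ≤ _ at h3
        omega
      have h7 : (3 * e : ℝ) ≤ (Av z).card := by exact_mod_cast h6
      linarith)
  have hP' : Prp G (F ∪ I) x' θ m := hP.step hm hw1 hw2 hind
  obtain ⟨y, hSy, hy01, hyw, hyp⟩ := hS'.round (fun u hu => by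
    obtain ⟨n, hn, _⟩ := hP'.val u hu
    exact ⟨n, hn⟩)
  refine ⟨F ∪ I, y, hSy, hy01, hP'.congr hyw, ?_⟩
  intro u hu
  have hu1 : u ∉ F := fun h => hu (Or.inl h)
  have hu2 : u ∉ I := fun h => hu (Or.inr h)
  have hpu := hp u hu1 hu2
  refine ⟨hu1, ?_⟩
  obtain ⟨n, hn⟩ := potx_nat (G := G) (F := F) h01 u
  have esum : (∑ z, if z ∈ (I : Set V) ∧ G.Adj u z then 1 - (if u ∈ Av z then (1/3 : ℝ) else 0) else 0)
      = ∑ z ∈ I.filter (G.Adj u), (1 - (if u ∈ Av z then (1/3 : ℝ) else 0)) := by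
    rw [← Finset.sum_filter]
    refine Finset.sum_congr ?_ fun _ _ => rfl
    ext z; simp
  replace hpu : potx G (F ∪ I) x' u ≤ potx G F x u -
      ∑ z ∈ I.filter (G.Adj u), (1 - (if u ∈ Av z then (1/3 : ℝ) else 0)) := by
    refine hpu.trans_eq ?_
    rw [← esum]
    congr!
  have hge : (2/3 : ℝ) * (I.filter (G.Adj u)).card ≤
      ∑ z ∈ I.filter (G.Adj u), (1 - (if u ∈ Av z then (1/3 : ℝ) else 0)) := by
    have : (2/3 : ℝ) * (I.filter (G.Adj u)).card = ∑ z ∈ I.filter (G.Adj u), (2/3 : ℝ) := by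
      rw [Finset.sum_const, nsmul_eq_mul]; ring
    rw [this]
    refine Finset.sum_le_sum fun z _ => ?_
    split_ifs <;> norm_num
  set s := ∑ z ∈ I.filter (G.Adj u), (1 - (if u ∈ Av z then (1/3 : ℝ) else 0)) with hs
  have h0 := potx_nonneg hS' u
  by_cases hT : u ∈ T
  · right
    obtain ⟨hd1, hd2⟩ := hdom u hT hu2
    have key : ∀ j : ℕ, (j : ℝ) ≤ s → potx G (F ∪ I) y u + j ≤ potx G F x u := by
      intro j hj
      have hjn : j ≤ n := by
        have : (j : ℝ) ≤ n := by linarith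
        exact_mod_cast this
      obtain ⟨l, rfl⟩ := Nat.exists_eq_add_of_le hjn
      have := hyp u l (by push_cast at hn; linarith)
      push_cast at hn
      linarith
    constructor
    · have := key 1 (by
        push_cast
        rcases Nat.lt_or_ge 1 (I.filter (G.Adj u)).card with h | h
        · have : (2 : ℝ) ≤ (I.filter (G.Adj u)).card := by exact_mod_cast h
          linarith
        · obtain ⟨z, hz⟩ := Finset.card_eq_one.1 (le_antisymm h hd1)
          have hnot : u ∉ Av z := by
            intro h'
            apply (Finset.mem_sdiff.1 h').2
            exact Finset.mem_filter.2 ⟨Finset.mem_sdiff.2 ⟨hT, hu2⟩, hz⟩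
          rw [hs, hz, Finset.sum_singleton, if_neg hnot]
          norm_num)
      simpa using this
    · intro hcd
      have := key 2 (by
        have : (3 : ℝ) ≤ (I.filter (G.Adj u)).card := by exact_mod_cast hd2 hcd
        push_cast
        linarith)
      simpa using this
  · left
    have hlt : potx G F x u < θ := by
      by_contra hc
      exact hT ((memT u).2 ⟨hu1, not_lt.1 hc⟩)
    have hnθ : n + 1 ≤ θ := by
      rw [hn] at hlt
      exact_mod_cast hlt
    have h1 : potx G (F ∪ I) y u ≤ n := hyp u n (by
      have : (0:ℝ) ≤ (I.filter (G.Adj u)).card := Nat.cast_nonneg _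
      linarith)
    have : (n : ℝ) + 1 ≤ θ := by exact_mod_cast hnθ
    linarith

theorem cycle2 {G : SimpleGraph V} {D : V → V → Prop} {F : Set V} {x : V → V → ℝ} {k : ℕ}
    (hD : BO G D k) (col : V → ℕ) (hcol : ∀ u v, G.Adj u v → col u ≠ col v)
    (r : ℕ) (hr : ∀ u, col u < r) (hr1 : 1 ≤ r)
    (hS : St G D F x) (h01 : ∀ u v, x u v = 0 ∨ x u v = 1)
    (a m e : ℕ) (ham : a + r ≤ m) (hP : Prp G F x (a + r + 1) m) (hae : k + 3 * r + 3 * e ≤ a + 1)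
    (hpot : ∀ u, u ∉ F → potx G F x u ≤ a + r + e + 1) :
    ∃ F' x', St G D F' x' ∧ (∀ u v, x' u v = 0 ∨ x' u v = 1) ∧ Prp G F' x' (a + 1) m ∧
      ∀ u, u ∉ F' → potx G F' x' u ≤ a + e := by
  have main : ∀ i j : ℕ, i + j = r → ∃ F' x', St G D F' x' ∧
      (∀ u v, x' u v = 0 ∨ x' u v = 1) ∧ Prp G F' x' (a + j + 1) m ∧
      ∀ u, u ∉ F' → potx G F' x' u ≤ a + j + e + 1 ∧
        (col u < i → potx G F' x' u ≤ a + j + e) := by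
    intro i
    induction i with
    | zero =>
      intro j hj
      obtain rfl : j = r := by omega
      exact ⟨F, x, hS, h01, hP, fun u hu => ⟨hpot u hu, fun h => absurd h (Nat.not_lt_zero _)⟩⟩
    | succ i ih =>
      intro j hj
      obtain ⟨F1, x1, hS1, h1, hP1, hb⟩ := ih (j + 1) (by omega)
      obtain ⟨F2, x2, hS2, h2, hP2, hc⟩ := level2 hD col hcol r hr hr1 hS1 h1 (a + j + 1) m
        (by omega) hP1 (e + 1) (by omega) (by
          intro u hu
          have := (hb u hu).1
          push_cast at this ⊢
          linarith) i
      refine ⟨F2, x2, hS2, h2, hP2, ?_⟩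
      intro u hu
      obtain ⟨hu1, h⟩ := hc u hu
      obtain ⟨b1, b2⟩ := hb u hu1
      have he : (0:ℝ) ≤ e := Nat.cast_nonneg e
      push_cast at *
      rcases h with h | ⟨g1, g2⟩
      · exact ⟨by linarith, fun _ => by linarith⟩
      · refine ⟨by linarith, fun hi => ?_⟩
        rcases Nat.lt_or_ge (col u) i with h' | h'
        · have := b2 h'; linarith
        · have := g2 (by omega); linarith
  obtain ⟨F', x', h1, h2, h3, h4⟩ := main r 0 (by omega)
  refine ⟨F', x', h1, h2, h3, fun u hu => ?_⟩
  have := (h4 u hu).2 (hr u)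
  push_cast at this
  linarith

theorem greedy {G : SimpleGraph V} {D : V → V → Prop} {k : ℕ} (hD : BO G D k) (m : ℕ) (n : ℕ) :
    ∀ (F : Set V) (x : V → V → ℝ), (Fᶜ).ncard = n → St G D F x →
      (∀ u v, x u v = 0 ∨ x u v = 1) → Prp G F x 0 m →
      (∀ u, u ∉ F → potx G F x u ≤ m) →
      (∀ v ∈ F, ∀ u, u ∉ F → potx G F x u ≤ wtx x v ∧ (G.Adj u v → potx G F x u < wtx x v)) →
      ∃ y, St G D Set.univ y ∧ (∀ u v, y u v = 0 ∨ y u v = 1) ∧ Prp G Set.univ y 0 m := by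
  induction n with
  | zero =>
    intro F x hn hS h01 hP _ _
    have : F = Set.univ := by
      rw [Set.ncard_eq_zero] at hn
      exact Set.compl_empty_iff.1 hn
    subst this
    exact ⟨x, hS, h01, hP⟩
  | succ n ih =>
    intro F x hn hS h01 hP hm hord
    have hne : (Fᶜ).Nonempty := by
      rw [← Set.ncard_pos]; omega
    obtain ⟨u, hu, hmax⟩ := Set.exists_max_image Fᶜ (potx G F x) (Set.toFinite _) hne
    obtain ⟨p, hpn⟩ := potx_nat (G := G) (F := F) h01 u
    have hind : ∀ a ∈ ({u} : Set V), ∀ b ∈ ({u} : Set V), ¬ G.Adj a b := by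
      rintro a rfl b rfl; exact G.irrefl
    obtain ⟨x', hS', hw1, hw2, hp⟩ := level_step hD hS {u} (by rintro z rfl; exact hu) hind
      (fun _ => ∅) (by simp) p 0 le_rfl zero_le_one (by rintro z rfl; exact hpn.ge)
      (by rintro z rfl; simp [hpn])
    have val' : ∀ v ∈ F ∪ {u}, ∃ n : ℕ, wtx x' v = n ∧ 0 ≤ n ∧ n ≤ m := by
      rintro v (hv | hv)
      · rw [hw1 v hv]; exact hP.val v hv
      · refine ⟨p, hw2 v hv, Nat.zero_le _, ?_⟩
        have := hm u hu
        rw [hpn] at this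
        exact_mod_cast this
    have hP' : Prp G (F ∪ {u}) x' 0 m := by
      refine ⟨val', ?_⟩
      rintro v (hv | hv) w (hw | hw) ha
      · rw [hw1 v hv, hw1 w hw]; exact hP.ne v hv w hw ha
      · rw [hw1 v hv, hw2 w hw, ← hpn]
        rw [Set.mem_singleton_iff] at hw
        subst hw
        exact ((hord v hv _ hu).2 ha.symm).ne'
      · rw [hw1 w hw, hw2 v hv, ← hpn]
        rw [Set.mem_singleton_iff] at hv
        subst hv
        exact ((hord w hw _ hu).2 ha).ne
      · exact absurd ha (hind v hv w hw)
    obtain ⟨y, hSy, hy01, hyw, hyp⟩ := hS'.round (fun v hv => by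
      obtain ⟨n, hn, _⟩ := val' v hv
      exact ⟨n, hn⟩)
    have drop : ∀ w, w ∉ F → w ≠ u → potx G (F ∪ {u}) y w ≤ potx G F x w ∧
        (G.Adj w u → potx G (F ∪ {u}) y w + 1 ≤ potx G F x w) := by
      intro w hw hwu
      have h1 := hp w hw hwu
      have es : (∑ z, if z ∈ ({u} : Set V) ∧ G.Adj w z then
          1 - (if w ∈ (∅ : Finset V) then (0:ℝ) else 0) else 0) = if G.Adj w u then 1 else 0 := by
        rw [Finset.sum_eq_single u]
        · simp
        · intro b _ hb; simp [hb]
        · simp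
      replace h1 : potx G (F ∪ {u}) x' w ≤ potx G F x w - if G.Adj w u then 1 else 0 := by
        refine h1.trans_eq ?_
        rw [← es]
        congr!
      obtain ⟨q, hq⟩ := potx_nat (G := G) (F := F) h01 w
      have h0 := potx_nonneg hS' w
      constructor
      · rw [hq]; apply hyp w q
        split_ifs at h1 <;> linarith
      · intro ha
        rw [if_pos ha] at h1
        have hq1 : 1 ≤ q := by
          have : (1:ℝ) ≤ q := by linarith
          exact_mod_cast this
        obtain ⟨l, rfl⟩ := Nat.exists_eq_add_of_le hq1
        push_cast at hq
        have := hyp w l (by linarith)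
        linarith
    have hwy1 : ∀ v ∈ F, wtx y v = wtx x v := fun v hv => by
      rw [hyw v (Or.inl hv), hw1 v hv]
    have hwy2 : wtx y u = potx G F x u := by
      rw [hyw u (Or.inr rfl), hw2 u rfl, hpn]
    apply ih (F ∪ {u}) y _ hSy hy01 (hP'.congr hyw)
    · intro w hw
      have hwF : w ∉ F := fun h => hw (Or.inl h)
      have hwu : w ≠ u := fun h => hw (Or.inr h)
      exact (drop w hwF hwu).1.trans (hm w hwF)
    · intro v hv w hw
      have hwF : w ∉ F := fun h => hw (Or.inl h)
      have hwu : w ≠ u := fun h => hw (Or.inr h)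
      obtain ⟨d1, d2⟩ := drop w hwF hwu
      rcases hv with hv | hv
      · rw [hwy1 v hv]
        obtain ⟨o1, o2⟩ := hord v hv w hwF
        exact ⟨d1.trans o1, fun h => lt_of_le_of_lt d1 (o2 h)⟩
      · rw [Set.mem_singleton_iff] at hv
        subst hv
        rw [hwy2]
        have := hmax w hwF
        exact ⟨d1.trans this, fun h => by linarith [d2 h]⟩
    · have e : (F ∪ {u})ᶜ = Fᶜ \ {u} := by
        ext w; simp [and_comm]
      rw [e, Set.ncard_sdiff_singleton_of_mem hu, hn]
      rfl

theorem to_orient {G : SimpleGraph V} {D : V → V → Prop} {y : V → V → ℝ} {m : ℕ}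
    (hS : St G D Set.univ y) (h01 : ∀ u v, y u v = 0 ∨ y u v = 1) (hP : Prp G Set.univ y 0 m) :
    ∃ o : GOrientation G, o.IsProper ∧ ∀ u, o.outDeg u ≤ m := by
  have hadj : ∀ u v, y u v = 1 → G.Adj u v := by
    intro u v h
    by_contra hn
    rw [hS.zero u v (fun h' => hn h'.1)] at h
    norm_num at h
  let o : GOrientation G :=
    { dir := fun u v => decide (y u v = 1)
      adj_iff := by
        intro u v
        simp only [decide_eq_true_eq]
        constructor
        · intro h
          have := hS.pair u v h (Or.inl trivial)
          rcases h01 u v with h1 | h1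
          · right; linarith
          · left; exact h1
        · rintro (h | h)
          · exact hadj u v h
          · exact (hadj v u h).symm
      not_both := by
        intro u v
        simp only [decide_eq_true_eq]
        rintro ⟨h1, h2⟩
        have := hS.pair u v (hadj u v h1) (Or.inl trivial)
        rw [h1, h2] at this
        norm_num at this }
  have hout : ∀ u, (o.outDeg u : ℝ) = wtx y u := by
    intro u
    rw [wtx_nat h01]
    have : o.outDeg u = (univ.filter fun v => y u v = 1).card := by
      unfold GOrientation.outDeg
      congr 1
      ext v
      simp [o]
    rw [this]
  refine ⟨o, ?_, ?_⟩
  · intro u v ha he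
    apply hP.ne u trivial v trivial ha
    rw [← hout, ← hout, he]
  · intro u
    obtain ⟨n, hn, _, hm⟩ := hP.val u trivial
    rw [← hout] at hn
    have : o.outDeg u = n := by exact_mod_cast hn
    omega

theorem finish {G : SimpleGraph V} {D : V → V → Prop} {F : Set V} {x : V → V → ℝ} {k : ℕ}
    (hD : BO G D k) (col : V → ℕ) (hcol : ∀ u v, G.Adj u v → col u ≠ col v)
    (r : ℕ) (hr : ∀ u, col u < r) (hr1 : 1 ≤ r)
    (hS : St G D F x) (a m : ℕ) (ham : a + 2 * r ≤ m) (hP : Prp G F x (a + 2 * r + 1) m)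
    (h1 : k + 3 * r + 3 ≤ a + r + 1) (h2 : k + 3 * r ≤ a + 1)
    (hpot : ∀ u, u ∉ F → potx G F x u ≤ a + 2 * r + 2) :
    ∃ o : GOrientation G, o.IsProper ∧ ∀ u, o.outDeg u ≤ m := by
  obtain ⟨y, hSy, hy01, hyw, hyp⟩ := hS.round (fun v hv => by
      obtain ⟨n, hn, _⟩ := hP.val v hv
      exact ⟨n, hn⟩)
  have hPy := hP.congr hyw
  obtain ⟨F1, x1, hS1, i1, hP1, b1⟩ := cycle2 hD col hcol r hr hr1 hSy hy01 (a + r) m 1 (by omega)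
    (by have : a + r + r + 1 = a + 2 * r + 1 := by ring
        rwa [this]) (by omega) (by
      intro u hu
      have := hyp u (a + 2 * r + 2) (by push_cast; exact hpot u hu)
      push_cast at this ⊢
      linarith)
  obtain ⟨F2, x2, hS2, i2, hP2, b2⟩ := cycle2 hD col hcol r hr hr1 hS1 i1 a m 0 (by omega)
    hP1 (by omega) (by
      intro u hu
      have := b1 u hu
      push_cast at this ⊢
      linarith)
  have ha : (a : ℝ) ≤ m := by exact_mod_cast (by omega : a ≤ m)
  obtain ⟨z, hSz, iz, hPz⟩ := greedy hD m _ F2 x2 rfl hS2 i2 ⟨fun u hu => by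
      obtain ⟨n, hn, _, hm⟩ := hP2.val u hu
      exact ⟨n, hn, Nat.zero_le _, hm⟩, hP2.ne⟩ (fun u hu => by
      have := b2 u hu
      push_cast at this
      linarith) (fun v hv u hu => by
      obtain ⟨n, hn, hl, hm⟩ := hP2.val v hv
      have h3 := b2 u hu
      have h4 : (a : ℝ) + 1 ≤ n := by exact_mod_cast hl
      push_cast at h3
      rw [hn]
      exact ⟨by linarith, fun _ => by linarith⟩)
  exact to_orient hSz iz hPz

end PO

theorem stmt18 {V : Type*} [Fintype V] (G : SimpleGraph V) (r k t : ℕ)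
    (hr : 2 ≤ r) (hcol : G.Colorable r) (hmad : mad G ≤ 2 * (k : ℝ))
    (ht : 1 ≤ t) (htpow : r - 1 ≤ t ^ (t + 1))
    (htmin : ∀ s : ℕ, 1 ≤ s → r - 1 ≤ s ^ (s + 1) → t ≤ s) :
    ∃ o : GOrientation G, o.IsProper ∧ ∀ u, o.outDeg u ≤ k + 3 * r * (t + 1) := by
  obtain ⟨D, hD1, hD2, hD3⟩ := hakimi G k hmad
  have hD : BO G D k := ⟨hD1, hD2, hD3⟩
  obtain ⟨c⟩ := hcol
  let col : V → ℕ := fun u => (c u : ℕ)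
  have hc : ∀ u v, G.Adj u v → col u ≠ col v := fun u v h e => c.valid h (Fin.ext e)
  have hcr : ∀ u, col u < r := fun u => (c u).2
  rcases Nat.lt_or_ge r 3 with h3 | h3
  · obtain rfl : r = 2 := by omega
    obtain ⟨F, x, hS, hP, hpot⟩ := cycle0 hD col hc 2 hcr (k + 10) (by omega)
    obtain ⟨o, ho, hb⟩ := finish hD col hc 2 hcr (by omega) hS (k + 6) (k + 12) (by omega) hP
      (by omega) (by omega) (fun u hu => by
        have := hpot u hu
        push_cast at this ⊢
        linarith)
    exact ⟨o, ho, fun u => (hb u).trans (by omega)⟩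
  · have ht2 : 2 ≤ t := by
      by_contra hn
      obtain rfl : t = 1 := by omega
      norm_num at htpow
      omega
    obtain ⟨F, x, hS, hP, hpot⟩ := phase1 hD col hc r t hcr h3 ht2 (by omega)
    have hrt : 2 * r ≤ r * t := by nlinarith
    have e1 : k + r * (2 * t + 2) = k + 2 * (r * t) + 2 * r := by ring
    have e2 : k + 3 * r * (t + 1) = k + 3 * (r * t) + 3 * r := by ring
    rw [e1] at hP hpot
    rw [e2] at hP ⊢
    exact finish hD col hc r hcr (by omega) hS (k + 2 * (r * t)) _ (by omega) hP
      (by omega) (by omega) (fun u hu => by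
        have := hpot u hu
        push_cast at this ⊢
        linarith)
end
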